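/- arXiv:1004.0516 — 10 statements merged into one kernel-verified Lean document; each statement's English description precedes it below -/
import Mathlib

section
/- Let ε ∈ {1,−1} be a sign and c₁, c₂, c₃ ∈ ℝ. Define the E₆ map f : ℝ² → ℝ² by f(x,y) = (3x² + c₃y² + c₁y, 4εy³ + 2c₃xy + 2c₂y + c₁x). If s ∈ ℝ² is a target point whose preimage set f⁻¹(s) consists of exactly 6 distinct points (x₁,y₁),…,(x₆,y₆), and J_f(x_i,y_i) ≠ 0 for every i (s is non-caustic), then the total signed magnification vanishes: Σ_{i=1}^{6} 1/J_f(x_i,y_i) = 0. -/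
/-- If two points of the plane have the same image under the `E₆` map, with first coordinate `a`,
then either they are equal or the Bezoutian of the map, reduced modulo the first equation,
vanishes at the pair. -/
lemma E6_bezoutian_eq_zero {ε c₁ c₂ c₃ a b x y u v : ℝ}
    (h₁ : 3 * x ^ 2 + c₃ * y ^ 2 + c₁ * y = a)
    (h₂ : 4 * ε * y ^ 3 + 2 * c₃ * x * y + 2 * c₂ * y + c₁ * x = b)
    (k₁ : 3 * u ^ 2 + c₃ * v ^ 2 + c₁ * v = a)
    (k₂ : 4 * ε * v ^ 3 + 2 * c₃ * u * v + 2 * c₂ * v + c₁ * u = b)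
    (hne : (x, y) ≠ (u, v)) :
    (12 * ε * x * y ^ 2 + 2 * c₃ * a + 6 * c₂ * x - (c₃ * y + c₁) * (2 * c₃ * y + c₁)) +
      u * (12 * ε * y ^ 2 + 6 * c₃ * x + 6 * c₂) +
      v * (12 * ε * x * y - 2 * c₃ * c₁ - c₃ * (2 * c₃ * y + c₁)) +
      u * v * (12 * ε * y) + v ^ 2 * (12 * ε * x - 2 * c₃ ^ 2) + u * v ^ 2 * (12 * ε) = 0 := by
  have key : (12 * ε * x * y ^ 2 + 2 * c₃ * a + 6 * c₂ * x
      - (c₃ * y + c₁) * (2 * c₃ * y + c₁)) +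
      u * (12 * ε * y ^ 2 + 6 * c₃ * x + 6 * c₂) +
      v * (12 * ε * x * y - 2 * c₃ * c₁ - c₃ * (2 * c₃ * y + c₁)) +
      u * v * (12 * ε * y) + v ^ 2 * (12 * ε * x - 2 * c₃ ^ 2) + u * v ^ 2 * (12 * ε) =
      3 * (x + u) * (4 * ε * (y ^ 2 + y * v + v ^ 2) + 2 * c₃ * u + 2 * c₂) -
        (c₃ * (y + v) + c₁) * (2 * c₃ * y + c₁) := by
    linear_combination (-2 * c₃) * k₁
  rw [key]
  by_cases hx : x = u
  · have hy : y - v ≠ 0 := fun h => hne (by rw [hx, sub_eq_zero.mp h])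
    refine (mul_eq_zero.mp ?_).resolve_left hy
    linear_combination (3 * (x + u)) * (h₂ - k₂) - (2 * c₃ * y + c₁) * (h₁ - k₁)
  · refine (mul_eq_zero.mp ?_).resolve_left (sub_ne_zero.mpr hx)
    linear_combination
      (4 * ε * (y ^ 2 + y * v + v ^ 2) + 2 * c₃ * u + 2 * c₂) * (h₁ - k₁) -
        (c₃ * (y + v) + c₁) * (h₂ - k₂)

/-- The Jacobian determinant of the `E₆` map. -/
lemma E6_jacobian (ε c₁ c₂ c₃ x y : ℝ) :
    deriv (fun t : ℝ => 3 * t ^ 2 + c₃ * y ^ 2 + c₁ * y) x *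
        deriv (fun t : ℝ => 4 * ε * t ^ 3 + 2 * c₃ * x * t + 2 * c₂ * t + c₁ * x) y -
      deriv (fun t : ℝ => 3 * x ^ 2 + c₃ * t ^ 2 + c₁ * t) y *
        deriv (fun t : ℝ => 4 * ε * y ^ 3 + 2 * c₃ * t * y + 2 * c₂ * y + c₁ * t) x =
      6 * x * (12 * ε * y ^ 2 + 2 * c₃ * x + 2 * c₂) - (2 * c₃ * y + c₁) ^ 2 := by
  have d₁ : HasDerivAt (fun t : ℝ => 3 * t ^ 2 + c₃ * y ^ 2 + c₁ * y) (6 * x) x :=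
    ((((hasDerivAt_pow 2 x).const_mul 3).add_const (c₃ * y ^ 2)).add_const (c₁ * y)).congr_deriv
      (by norm_num; ring)
  have d₂ : HasDerivAt (fun t : ℝ => 4 * ε * t ^ 3 + 2 * c₃ * x * t + 2 * c₂ * t + c₁ * x)
      (12 * ε * y ^ 2 + 2 * c₃ * x + 2 * c₂) y :=
    (((((hasDerivAt_pow 3 y).const_mul (4 * ε)).add
      ((hasDerivAt_id y).const_mul (2 * c₃ * x))).add
      ((hasDerivAt_id y).const_mul (2 * c₂))).add_const (c₁ * x)).congr_deriv
      (by norm_num; ring)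
  have d₃ : HasDerivAt (fun t : ℝ => 3 * x ^ 2 + c₃ * t ^ 2 + c₁ * t) (2 * c₃ * y + c₁) y :=
    ((((hasDerivAt_pow 2 y).const_mul c₃).const_add (3 * x ^ 2)).add
      ((hasDerivAt_id y).const_mul c₁)).congr_deriv (by norm_num; ring)
  have d₄ : HasDerivAt (fun t : ℝ => 4 * ε * y ^ 3 + 2 * c₃ * t * y + 2 * c₂ * y + c₁ * t)
      (2 * c₃ * y + c₁) x :=
    ((((((hasDerivAt_id x).const_mul (2 * c₃)).mul_const y).const_add
      (4 * ε * y ^ 3)).add_const (2 * c₂ * y)).add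
      ((hasDerivAt_id x).const_mul c₁)).congr_deriv (by ring)
  rw [d₁.deriv, d₂.deriv, d₃.deriv, d₄.deriv]
  ring


/-- E₆ magnification relation. -/
theorem E6_magnification_relation (ε : ℝ) (hε : ε = 1 ∨ ε = -1)
    (c₁ c₂ c₃ : ℝ) (s : ℝ × ℝ)
    (f : ℝ × ℝ → ℝ × ℝ)
    (hf : ∀ x y : ℝ, f (x, y) =
      (3 * x ^ 2 + c₃ * y ^ 2 + c₁ * y,
       4 * ε * y ^ 3 + 2 * c₃ * x * y + 2 * c₂ * y + c₁ * x))
    (J : ℝ × ℝ → ℝ)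
    (hJ : ∀ x y : ℝ, J (x, y) =
      deriv (fun t => (f (t, y)).1) x * deriv (fun t => (f (x, t)).2) y -
      deriv (fun t => (f (x, t)).1) y * deriv (fun t => (f (t, y)).2) x)
    (p : Fin 6 → ℝ × ℝ) (hp : Function.Injective p)
    (hpre : f ⁻¹' {s} = Set.range p)
    (hnc : ∀ i, J (p i) ≠ 0) :
    ∑ i, 1 / J (p i) = 0 := by
  have hε0 : ε ≠ 0 := by rcases hε with rfl | rfl <;> norm_num
  have hJ' (i) : J (p i) = 6 * (p i).1 * (12 * ε * (p i).2 ^ 2 + 2 * c₃ * (p i).1 + 2 * c₂) -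
      (2 * c₃ * (p i).2 + c₁) ^ 2 := by
    rw [← E6_jacobian, ← Prod.mk.eta (p := p i), hJ]
    simp only [hf]
  have hs (i) : f ((p i).1, (p i).2) = s := by
    have : p i ∈ f ⁻¹' {s} := hpre ▸ Set.mem_range_self i
    exact this
  have h₁ (i) : 3 * (p i).1 ^ 2 + c₃ * (p i).2 ^ 2 + c₁ * (p i).2 = s.1 := by
    rw [← hs i, hf]
  have h₂ (i) : 4 * ε * (p i).2 ^ 3 + 2 * c₃ * (p i).1 * (p i).2 + 2 * c₂ * (p i).2 +
      c₁ * (p i).1 = s.2 := by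
    rw [← hs i, hf]
  -- The monomial basis of the coordinate ring, evaluated at the six points.
  let V : Matrix (Fin 6) (Fin 6) ℝ := Matrix.of fun j =>
    ![1, (p j).1, (p j).2, (p j).1 * (p j).2, (p j).2 ^ 2, (p j).1 * (p j).2 ^ 2]
  -- The coefficients of the Bezoutian in this basis.
  let W : Matrix (Fin 6) (Fin 6) ℝ := Matrix.of fun k i =>
    ![12 * ε * (p i).1 * (p i).2 ^ 2 + 2 * c₃ * s.1 + 6 * c₂ * (p i).1 -
        (c₃ * (p i).2 + c₁) * (2 * c₃ * (p i).2 + c₁),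
      12 * ε * (p i).2 ^ 2 + 6 * c₃ * (p i).1 + 6 * c₂,
      12 * ε * (p i).1 * (p i).2 - 2 * c₃ * c₁ - c₃ * (2 * c₃ * (p i).2 + c₁),
      12 * ε * (p i).2,
      12 * ε * (p i).1 - 2 * c₃ ^ 2,
      12 * ε] k
  have hVW : V * W = Matrix.diagonal fun i => J (p i) := by
    ext j i
    simp only [V, W, Matrix.mul_apply, Matrix.of_apply, Fin.sum_univ_six, Matrix.cons_val]
    by_cases hij : j = i
    · subst hij
      rw [Matrix.diagonal_apply_eq, hJ']
      linear_combination (-2 * c₃) * h₁ j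
    · rw [Matrix.diagonal_apply_ne _ hij]
      have := E6_bezoutian_eq_zero (h₁ i) (h₂ i) (h₁ j) (h₂ j) fun h => hij (hp h).symm
      linear_combination this
  have hV : IsUnit V.det := by
    have hdet : V.det * W.det = ∏ i, J (p i) := by
      rw [← Matrix.det_mul, hVW, Matrix.det_diagonal]
    have hprod : V.det * W.det ≠ 0 := hdet ▸ Finset.prod_ne_zero_iff.mpr fun i _ => hnc i
    exact isUnit_iff_ne_zero.mpr (left_ne_zero_of_mul hprod)
  have hW : W.mulVec (fun i => 1 / J (p i)) = Pi.single 0 1 := by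
    refine Matrix.mulVec_injective_iff_isUnit.mpr ((Matrix.isUnit_iff_isUnit_det V).mpr hV) ?_
    change V.mulVec _ = V.mulVec _
    rw [Matrix.mulVec_mulVec, hVW, Matrix.mulVec_single_one]
    ext j
    rw [Matrix.mulVec_diagonal, mul_one_div_cancel (hnc j)]
    rfl
  have hlast : ∑ i, 12 * ε * (1 / J (p i)) = 0 := congrFun hW 5
  rw [← Finset.mul_sum] at hlast
  exact (mul_eq_zero.mp hlast).resolve_left (mul_ne_zero (by norm_num) hε0)
end

section
/- Let c₁, c₂, c₃, c₄ ∈ ℝ. Define the E₇ map f : ℝ² → ℝ² by f(x,y) = (3x² + y³ + c₁y, 3xy² + 4c₄y³ + 3c₃y² + 2c₂y + c₁x). If s ∈ ℝ² is a target point whose preimage set f⁻¹(s) consists of exactly 7 distinct points (x₁,y₁),…,(x₇,y₇), and J_f(x_i,y_i) ≠ 0 for every i (s is non-caustic), then the total signed magnification vanishes: Σ_{i=1}^{7} 1/J_f(x_i,y_i) = 0. -/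
/-- If a product of square matrices is an invertible diagonal matrix `diagonal d`, then the
`d⁻¹`-weighted pairings of rows of `B` with columns of `A` are the entries of the identity. -/
theorem Matrix.sum_mul_mul_inv_of_mul_eq_diagonal {n K : Type*} [Fintype n] [DecidableEq n]
    [Field K] {A B : Matrix n n K} {d : n → K} (hd : ∀ i, d i ≠ 0)
    (h : A * B = Matrix.diagonal d) (k l : n) :
    ∑ i, B k i * (d i)⁻¹ * A i l = (1 : Matrix n n K) k l := by
  have hright : A * (B * Matrix.diagonal fun i => (d i)⁻¹) = 1 := by
    rw [← Matrix.mul_assoc, h, Matrix.diagonal_mul_diagonal, ← Matrix.diagonal_one]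
    congr 1
    funext i
    exact mul_inv_cancel₀ (hd i)
  rw [← mul_eq_one_comm.mp hright, Matrix.mul_apply]
  simp only [Matrix.mul_diagonal]

/-- The monomial basis `1, y, y², y³, y⁴, x, xy` of the local algebra of the `E₇` map. -/
def e7Basis (x y : ℝ) : Fin 7 → ℝ := ![1, y, y ^ 2, y ^ 3, y ^ 4, x, x * y]

/-- Coefficients, with respect to `e7Basis`, of the Bezoutian of the `E₇` map over a target
point with second coordinate `s₂`. -/
def e7Dual (c₁ c₂ c₃ c₄ s₂ x y : ℝ) : Fin 7 → ℝ :=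
  ![4 * c₄ * s₂ + 3 * x * (3 * x * y + 4 * c₄ * y ^ 2 + 3 * c₃ * y + 2 * c₂) - c₁ * (y ^ 2 + c₁),
    -8 * c₄ * c₂ + 3 * x * (3 * x + 4 * c₄ * y + 3 * c₃) - c₁ * y,
    -12 * c₄ * c₃ + 12 * c₄ * x - c₁ - 3 * (y ^ 2 + c₁),
    -16 * c₄ ^ 2 - 3 * y,
    -3,
    3 * (3 * x * y + 4 * c₄ * y ^ 2 + 3 * c₃ * y + 2 * c₂) - 4 * c₄ * c₁,
    3 * (3 * x + 4 * c₄ * y + 3 * c₃)]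

/-- Over a fibre of the `E₇` map, pairing `e7Basis` with `e7Dual` gives the Bezoutian. -/
theorem e7Basis_mul_e7Dual (c₁ c₂ c₃ c₄ s₂ x y x' y' : ℝ)
    (h : 3 * x * y ^ 2 + 4 * c₄ * y ^ 3 + 3 * c₃ * y ^ 2 + 2 * c₂ * y + c₁ * x = s₂) :
    ∑ k, e7Basis x y k * e7Dual c₁ c₂ c₃ c₄ s₂ x' y' k =
      3 * (x + x') * (3 * x' * (y + y') + 4 * c₄ * (y ^ 2 + y * y' + y' ^ 2)
        + 3 * c₃ * (y + y') + 2 * c₂)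
      - (y ^ 2 + y * y' + y' ^ 2 + c₁) * (3 * y ^ 2 + c₁) := by
  subst h
  simp [Fin.sum_univ_succ, e7Basis, e7Dual]
  ring

/-- The Bezoutian vanishes on pairs of distinct points of a fibre of the `E₇` map. -/
theorem e7Bezoutian_eq_zero {c₁ c₂ c₃ c₄ x y x' y' : ℝ}
    (h₁ : 3 * x ^ 2 + y ^ 3 + c₁ * y = 3 * x' ^ 2 + y' ^ 3 + c₁ * y')
    (h₂ : 3 * x * y ^ 2 + 4 * c₄ * y ^ 3 + 3 * c₃ * y ^ 2 + 2 * c₂ * y + c₁ * x =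
      3 * x' * y' ^ 2 + 4 * c₄ * y' ^ 3 + 3 * c₃ * y' ^ 2 + 2 * c₂ * y' + c₁ * x')
    (hne : (x, y) ≠ (x', y')) :
    3 * (x + x') * (3 * x' * (y + y') + 4 * c₄ * (y ^ 2 + y * y' + y' ^ 2)
        + 3 * c₃ * (y + y') + 2 * c₂)
      - (y ^ 2 + y * y' + y' ^ 2 + c₁) * (3 * y ^ 2 + c₁) = 0 := by
  by_cases hx : x = x'
  · have hy : y - y' ≠ 0 := sub_ne_zero.mpr fun hy => hne (by rw [hx, hy])
    refine (mul_eq_zero.mp ?_).resolve_left hy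
    linear_combination 3 * (x + x') * h₂ - (3 * y ^ 2 + c₁) * h₁
  · refine (mul_eq_zero.mp ?_).resolve_left (sub_ne_zero.mpr hx)
    linear_combination (3 * x' * (y + y') + 4 * c₄ * (y ^ 2 + y * y' + y' ^ 2)
        + 3 * c₃ * (y + y') + 2 * c₂) * h₁ - (y ^ 2 + y * y' + y' ^ 2 + c₁) * h₂


/-- E₇ magnification relation. -/
theorem E7_magnification_relation (c₁ c₂ c₃ c₄ : ℝ) (s : ℝ × ℝ)
    (f : ℝ × ℝ → ℝ × ℝ)
    (hf : ∀ x y : ℝ, f (x, y) =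
      (3 * x ^ 2 + y ^ 3 + c₁ * y,
       3 * x * y ^ 2 + 4 * c₄ * y ^ 3 + 3 * c₃ * y ^ 2 + 2 * c₂ * y + c₁ * x))
    (J : ℝ × ℝ → ℝ)
    (hJ : ∀ x y : ℝ, J (x, y) =
      deriv (fun t => (f (t, y)).1) x * deriv (fun t => (f (x, t)).2) y -
      deriv (fun t => (f (x, t)).1) y * deriv (fun t => (f (t, y)).2) x)
    (p : Fin 7 → ℝ × ℝ) (hp : Function.Injective p)
    (hpre : f ⁻¹' {s} = Set.range p)
    (hnc : ∀ i, J (p i) ≠ 0) :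
    ∑ i, 1 / J (p i) = 0 := by
  have hJ' : ∀ x y : ℝ, J (x, y) =
      6 * x * (6 * x * y + 12 * c₄ * y ^ 2 + 6 * c₃ * y + 2 * c₂) - (3 * y ^ 2 + c₁) ^ 2 := by
    intro x y
    have hxx : HasDerivAt (fun t : ℝ => 3 * t ^ 2 + y ^ 3 + c₁ * y) (6 * x) x := by
      refine (((((hasDerivAt_id' x).pow 2).const_mul 3).add_const _).add_const _).congr_deriv ?_
      norm_num
      ring
    have hyx : HasDerivAt (fun t : ℝ => 3 * x ^ 2 + t ^ 3 + c₁ * t) (3 * y ^ 2 + c₁) y := by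
      refine ((((hasDerivAt_id' y).pow 3).const_add _).add
        ((hasDerivAt_id' y).const_mul c₁)).congr_deriv ?_
      norm_num
    have hxy : HasDerivAt (fun t : ℝ => 3 * t * y ^ 2 + 4 * c₄ * y ^ 3 + 3 * c₃ * y ^ 2
        + 2 * c₂ * y + c₁ * t) (3 * y ^ 2 + c₁) x := by
      refine (((((((hasDerivAt_id' x).const_mul 3).mul_const _).add_const _).add_const _).add_const
        _).add ((hasDerivAt_id' x).const_mul c₁)).congr_deriv ?_
      ring
    have hyy : HasDerivAt (fun t : ℝ => 3 * x * t ^ 2 + 4 * c₄ * t ^ 3 + 3 * c₃ * t ^ 2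
        + 2 * c₂ * t + c₁ * x) (6 * x * y + 12 * c₄ * y ^ 2 + 6 * c₃ * y + 2 * c₂) y := by
      refine (((((((hasDerivAt_id' y).pow 2).const_mul (3 * x)).add
        (((hasDerivAt_id' y).pow 3).const_mul (4 * c₄))).add
        (((hasDerivAt_id' y).pow 2).const_mul (3 * c₃))).add
        ((hasDerivAt_id' y).const_mul (2 * c₂))).add_const _).congr_deriv ?_
      norm_num
      ring
    rw [hJ]
    simp only [hf]
    rw [hxx.deriv, hyx.deriv, hxy.deriv, hyy.deriv]
    ring
  have hfib : ∀ i, f ((p i).1, (p i).2) = s := fun i => by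
    have hi : p i ∈ f ⁻¹' {s} := hpre ▸ Set.mem_range_self i
    exact hi
  have h₁ := fun i => congrArg Prod.fst ((hf _ _).symm.trans (hfib i))
  have h₂ := fun i => congrArg Prod.snd ((hf _ _).symm.trans (hfib i))
  dsimp only at h₁ h₂
  let A : Matrix (Fin 7) (Fin 7) ℝ := Matrix.of fun i => e7Basis (p i).1 (p i).2
  let B : Matrix (Fin 7) (Fin 7) ℝ :=
    Matrix.of fun k i => e7Dual c₁ c₂ c₃ c₄ s.2 (p i).1 (p i).2 k
  have hAB : A * B = Matrix.diagonal fun i => J (p i) := by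
    ext i j
    rw [Matrix.mul_apply]
    simp only [A, B, Matrix.of_apply]
    rw [e7Basis_mul_e7Dual _ _ _ _ _ _ _ _ _ (h₂ i)]
    rcases eq_or_ne i j with rfl | hij
    · rw [Matrix.diagonal_apply_eq]
      refine Eq.trans ?_ (hJ' (p i).1 (p i).2).symm
      ring
    · rw [Matrix.diagonal_apply_ne _ hij]
      exact e7Bezoutian_eq_zero ((h₁ i).trans (h₁ j).symm) ((h₂ i).trans (h₂ j).symm)
        (hp.ne hij)
  have hsum := Matrix.sum_mul_mul_inv_of_mul_eq_diagonal hnc hAB 4 0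
  have hB : ∀ i, B 4 i = -3 := fun _ => rfl
  have hA : ∀ i, A i 0 = 1 := fun _ => rfl
  simp only [hA, hB, mul_one, ← Finset.mul_sum] at hsum
  rw [Matrix.one_apply_ne (by decide)] at hsum
  simpa only [one_div] using (mul_eq_zero.mp hsum).resolve_left (by norm_num)
end

section
/- Let c₁, c₂, c₃, c₄, c₅ ∈ ℝ. Define the E₈ map f : ℝ² → ℝ² by f(x,y) = (3x² + c₅y³ + c₄y² + c₁y, 5y⁴ + 3c₅xy² + 2c₄xy + 3c₃y² + 2c₂y + c₁x). If s ∈ ℝ² is a target point whose preimage set f⁻¹(s) consists of exactly 8 distinct points (x₁,y₁),…,(x₈,y₈), and J_f(x_i,y_i) ≠ 0 for every i (s is non-caustic), then the total signed magnification vanishes: Σ_{i=1}^{8} 1/J_f(x_i,y_i) = 0. -/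
/-- If `V * N` is diagonal with nonzero diagonal entries `d`, the first column of `V` consists of
ones and the last row of `N` is constant and nonzero, then the reciprocals of `d` sum to zero. -/
theorem sum_one_div_eq_zero_of_mul_eq_diagonal {K : Type*} [Field K] {n : ℕ}
    (V N : Matrix (Fin (n + 2)) (Fin (n + 2)) K) (d : Fin (n + 2) → K) (hd : ∀ i, d i ≠ 0)
    (hVN : V * N = Matrix.diagonal d) (hV : ∀ i, V i 0 = 1) {k : K} (hk : k ≠ 0)
    (hN : ∀ j, N (Fin.last _) j = k) : ∑ i, 1 / d i = 0 := by
  have hdet : V.det ≠ 0 := by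
    have h : V.det * N.det ≠ 0 := by
      rw [← Matrix.det_mul, hVN, Matrix.det_diagonal]
      exact Finset.prod_ne_zero_iff.mpr fun i _ => hd i
    exact left_ne_zero_of_mul h
  have hinj : Function.Injective V.mulVec :=
    Matrix.mulVec_injective_of_isUnit ((Matrix.isUnit_iff_isUnit_det V).mpr hdet.isUnit)
  have hcol : N.mulVec (fun j => 1 / d j) = Pi.single 0 1 := by
    apply hinj
    rw [Matrix.mulVec_mulVec, hVN, Matrix.mulVec_single_one]
    ext i
    simp [Matrix.mulVec_diagonal, hV, hd]
  have hlast := congrFun hcol (Fin.last _)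
  rw [Pi.single_eq_of_ne (Fin.last_pos.ne'), Matrix.mulVec, dotProduct] at hlast
  simp only [hN, ← Finset.mul_sum] at hlast
  exact (mul_eq_zero.mp hlast).resolve_left hk

/-- A `2 × 2` linear system with a nonzero solution has vanishing determinant. -/
theorem det_eq_zero_of_linear_relations {K : Type*} [Field K] {a b c d u v : K}
    (h₁ : u * a + v * b = 0) (h₂ : u * c + v * d = 0) (h : u ≠ 0 ∨ v ≠ 0) :
    a * d - b * c = 0 := by
  rcases h with h | h
  · exact (mul_eq_zero.mp (by linear_combination d * h₁ - b * h₂ :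
      u * (a * d - b * c) = 0)).resolve_left h
  · exact (mul_eq_zero.mp (by linear_combination a * h₂ - c * h₁ :
      v * (a * d - b * c) = 0)).resolve_left h

/-- The monomials spanning the coordinate ring of a fibre of the E₈ map. -/
def e8Monomials (q : ℝ × ℝ) : Fin 8 → ℝ :=
  ![1, q.2, q.2 ^ 2, q.2 ^ 3, q.1, q.1 * q.2, q.1 * q.2 ^ 2, q.1 * q.2 ^ 3]

/-- The coefficients, with respect to `e8Monomials`, of the Bezoutian of the E₈ map on a fibre
whose second target coordinate is `t`. -/
noncomputable def e8BezoutianCoeff (c₁ c₂ c₃ c₄ c₅ t : ℝ) (q : ℝ × ℝ) : Fin 8 → ℝ :=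
  let u := q.1
  let v := q.2
  let k := 3 * c₅ ^ 2 / 5
  let a := c₅ * v ^ 2 + c₄ * v + c₁
  let e := 5 * v ^ 3 + 3 * c₃ * v + 2 * c₂ + 3 * c₅ * u * v + 2 * c₄ * u
  let g := 5 * v ^ 2 + 3 * c₃ + 3 * c₅ * u
  ![3 * u * e - c₁ * a - k * t,
    3 * u * g - (c₁ * (c₅ * v + c₄) + 2 * c₄ * a) + 2 * k * c₂,
    15 * u * v - (c₁ * c₅ + 2 * c₄ * (c₅ * v + c₄) + 3 * c₅ * a) + 3 * k * c₃,
    15 * u - (5 * c₄ * c₅ + 3 * c₅ ^ 2 * v),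
    3 * e + k * c₁,
    3 * g + 2 * k * c₄,
    15 * v + 3 * k * c₅,
    15]

/-- On a fibre, `e8BezoutianCoeff` expands the determinant of divided differences. -/
theorem sum_e8Monomials_mul_e8BezoutianCoeff (c₁ c₂ c₃ c₄ c₅ t x y u v : ℝ)
    (h : 5 * y ^ 4 + 3 * c₅ * x * y ^ 2 + 2 * c₄ * x * y + 3 * c₃ * y ^ 2 + 2 * c₂ * y + c₁ * x
      = t) :
    ∑ l, e8Monomials (x, y) l * e8BezoutianCoeff c₁ c₂ c₃ c₄ c₅ t (u, v) l =
      3 * (x + u) * (5 * (y ^ 3 + y ^ 2 * v + y * v ^ 2 + v ^ 3) + 3 * c₃ * (y + v) + 2 * c₂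
        + u * (3 * c₅ * (y + v) + 2 * c₄)) -
      (c₅ * (y ^ 2 + y * v + v ^ 2) + c₄ * (y + v) + c₁) *
        (3 * c₅ * y ^ 2 + 2 * c₄ * y + c₁) := by
  simp [e8Monomials, e8BezoutianCoeff, Fin.sum_univ_succ]
  linear_combination (3 * c₅ ^ 2 / 5) * h

/-- E₈ magnification relation. -/
theorem E8_magnification_relation (c₁ c₂ c₃ c₄ c₅ : ℝ) (s : ℝ × ℝ)
    (f : ℝ × ℝ → ℝ × ℝ)
    (hf : ∀ x y : ℝ, f (x, y) =
      (3 * x ^ 2 + c₅ * y ^ 3 + c₄ * y ^ 2 + c₁ * y,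
       5 * y ^ 4 + 3 * c₅ * x * y ^ 2 + 2 * c₄ * x * y + 3 * c₃ * y ^ 2 + 2 * c₂ * y + c₁ * x))
    (J : ℝ × ℝ → ℝ)
    (hJ : ∀ x y : ℝ, J (x, y) =
      deriv (fun t => (f (t, y)).1) x * deriv (fun t => (f (x, t)).2) y -
      deriv (fun t => (f (x, t)).1) y * deriv (fun t => (f (t, y)).2) x)
    (p : Fin 8 → ℝ × ℝ) (hp : Function.Injective p)
    (hpre : f ⁻¹' {s} = Set.range p)
    (hnc : ∀ i, J (p i) ≠ 0) :
    ∑ i, 1 / J (p i) = 0 := by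
  have hJ' : ∀ x y : ℝ, J (x, y) =
      (6 * x) * (20 * y ^ 3 + 6 * c₅ * x * y + 2 * c₄ * x + 6 * c₃ * y + 2 * c₂) -
      (3 * c₅ * y ^ 2 + 2 * c₄ * y + c₁) * (3 * c₅ * y ^ 2 + 2 * c₄ * y + c₁) := by
    intro x y
    have h₁ : HasDerivAt (fun t => (f (t, y)).1) (6 * x) x := by
      simp only [hf]
      refine HasDerivAt.congr_deriv
        ((((((hasDerivAt_id x).pow 2).const_mul 3).add_const (c₅ * y ^ 3)).add_const
        (c₄ * y ^ 2)).add_const (c₁ * y)) ?_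
      simp only [id_eq]
      push_cast
      ring
    have h₂ : HasDerivAt (fun t => (f (x, t)).2)
        (20 * y ^ 3 + 6 * c₅ * x * y + 2 * c₄ * x + 6 * c₃ * y + 2 * c₂) y := by
      simp only [hf]
      refine HasDerivAt.congr_deriv
        (((((((hasDerivAt_id y).pow 4).const_mul 5).add
        (((hasDerivAt_id y).pow 2).const_mul (3 * c₅ * x))).add
        ((hasDerivAt_id y).const_mul (2 * c₄ * x))).add
        (((hasDerivAt_id y).pow 2).const_mul (3 * c₃))).add
        ((hasDerivAt_id y).const_mul (2 * c₂)) |>.add_const (c₁ * x)) ?_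
      simp only [id_eq]
      push_cast
      ring
    have h₃ : HasDerivAt (fun t => (f (x, t)).1) (3 * c₅ * y ^ 2 + 2 * c₄ * y + c₁) y := by
      simp only [hf]
      refine HasDerivAt.congr_deriv
        ((((((hasDerivAt_id y).pow 3).const_mul c₅).const_add (3 * x ^ 2)).add
        (((hasDerivAt_id y).pow 2).const_mul c₄)).add ((hasDerivAt_id y).const_mul c₁)) ?_
      simp only [id_eq]
      push_cast
      ring
    have h₄ : HasDerivAt (fun t => (f (t, y)).2) (3 * c₅ * y ^ 2 + 2 * c₄ * y + c₁) x := by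
      have h : (fun t => (f (t, y)).2) = fun t =>
          (3 * c₅ * y ^ 2 + 2 * c₄ * y + c₁) * t + (5 * y ^ 4 + 3 * c₃ * y ^ 2 + 2 * c₂ * y) := by
        ext t
        simp only [hf]
        ring
      rw [h]
      simpa using ((hasDerivAt_id x).const_mul
        (3 * c₅ * y ^ 2 + 2 * c₄ * y + c₁)).add_const (5 * y ^ 4 + 3 * c₃ * y ^ 2 + 2 * c₂ * y)
    rw [hJ, h₁.deriv, h₂.deriv, h₃.deriv, h₄.deriv]
  have hfib : ∀ i, f (p i) = s := fun i => by
    have : p i ∈ f ⁻¹' {s} := hpre ▸ Set.mem_range_self i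
    simpa using this
  refine sum_one_div_eq_zero_of_mul_eq_diagonal
    (Matrix.of fun i => e8Monomials (p i))
    (Matrix.of fun l j => e8BezoutianCoeff c₁ c₂ c₃ c₄ c₅ s.2 (p j) l) _ hnc ?_ (fun _ => rfl)
    (k := 15) (by norm_num) (fun _ => rfl)
  ext i j
  have hi := hfib i
  have hj := hfib j
  have hij : i ≠ j → p i ≠ p j := hp.ne
  rw [Matrix.mul_apply]
  simp only [Matrix.of_apply]
  rcases eq_or_ne i j with rfl | hne
  · rw [Matrix.diagonal_apply_eq]
    generalize p i = q at hi ⊢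
    obtain ⟨x, y⟩ := q
    rw [hf] at hi
    rw [sum_e8Monomials_mul_e8BezoutianCoeff _ _ _ _ _ _ _ _ _ _ (congrArg Prod.snd hi), hJ']
    ring
  · rw [Matrix.diagonal_apply_ne _ hne]
    replace hij := hij hne
    generalize p i = q, p j = r at hi hj hij ⊢
    obtain ⟨x, y⟩ := q
    obtain ⟨u, v⟩ := r
    rw [hf] at hi hj
    obtain ⟨hi₁, hi₂⟩ := Prod.ext_iff.mp hi
    obtain ⟨hj₁, hj₂⟩ := Prod.ext_iff.mp hj
    dsimp only at hi₁ hi₂ hj₁ hj₂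
    rw [sum_e8Monomials_mul_e8BezoutianCoeff _ _ _ _ _ _ _ _ _ _ hi₂]
    refine det_eq_zero_of_linear_relations (u := x - u) (v := y - v) ?_ ?_ ?_
    · linear_combination hi₁ - hj₁
    · linear_combination hi₂ - hj₂
    · rw [sub_ne_zero, sub_ne_zero]
      by_contra! h
      exact hij (Prod.ext h.1 h.2)
end

section
/- Let c ∈ ℝ. Define the elliptic umbilic (D₄⁻) lensing map η : ℝ² → ℝ² by η(x,y) = (x² − y², −2xy + 4cy). If s ∈ ℝ² is a target point whose preimage set η⁻¹(s) consists of exactly 4 distinct points (x₁,y₁),…,(x₄,y₄), and J_η(x_i,y_i) ≠ 0 for every i (s is non-caustic), then the total signed magnification vanishes: Σ_{i=1}^{4} 1/J_η(x_i,y_i) = 0. -/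
/-- The derivative of a monic quartic with four distinct roots, evaluated at one of them. -/
lemma quartic_derivative_at_root {A B C D u v w z : ℝ}
    (huv : u ≠ v) (huw : u ≠ w) (huz : u ≠ z) (hvw : v ≠ w) (hvz : v ≠ z) (hwz : w ≠ z)
    (hu : u ^ 4 + A * u ^ 3 + B * u ^ 2 + C * u + D = 0)
    (hv : v ^ 4 + A * v ^ 3 + B * v ^ 2 + C * v + D = 0)
    (hw : w ^ 4 + A * w ^ 3 + B * w ^ 2 + C * w + D = 0)
    (hz : z ^ 4 + A * z ^ 3 + B * z ^ 2 + C * z + D = 0) :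
    4 * u ^ 3 + 3 * A * u ^ 2 + 2 * B * u + C = (u - v) * (u - w) * (u - z) := by
  have first (t : ℝ) (hut : u ≠ t) (ht : t ^ 4 + A * t ^ 3 + B * t ^ 2 + C * t + D = 0) :
      u ^ 3 + u ^ 2 * t + u * t ^ 2 + t ^ 3 + A * (u ^ 2 + u * t + t ^ 2) + B * (u + t) + C
        = 0 :=
    mul_left_cancel₀ (sub_ne_zero.2 hut) (by linear_combination hu - ht)
  have second (t : ℝ) (hut : u ≠ t) (hvt : v ≠ t)
      (ht : t ^ 4 + A * t ^ 3 + B * t ^ 2 + C * t + D = 0) :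
      u ^ 2 + u * (v + t) + v ^ 2 + v * t + t ^ 2 + A * (u + v + t) + B = 0 :=
    mul_left_cancel₀ (sub_ne_zero.2 hvt)
      (by linear_combination first v huv hv - first t hut ht)
  have hA : u + v + w + z + A = 0 :=
    mul_left_cancel₀ (sub_ne_zero.2 hwz)
      (by linear_combination second w huw hvw hw - second z huz hvz hz)
  have hB := second w huw hvw hw
  have hC := first v huv hv
  obtain rfl : A = -(u + v + w + z) := by linarith
  obtain rfl : B = -(u ^ 2 + u * (v + w) + v ^ 2 + v * w + w ^ 2
    + -(u + v + w + z) * (u + v + w)) := by linarith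
  linear_combination hC

/-- The magnification relation off the axis `b = 0`, where `x` separates the preimages. -/
lemma sum_inv_jacobian_of_ne_zero {c a b : ℝ} (hb : b ≠ 0) {x y : Fin 4 → ℝ}
    (hp : ∀ i j, x i = x j → y i = y j → i = j)
    (h1 : ∀ i, x i ^ 2 - y i ^ 2 = a) (h2 : ∀ i, -2 * x i * y i + 4 * c * y i = b) :
    ∑ i, 1 / (-4 * x i ^ 2 + 8 * c * x i - 4 * y i ^ 2) = 0 := by
  have hx (i) : x i - 2 * c ≠ 0 := fun h => hb (by
    linear_combination -h2 i - 2 * y i * h)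
  have hinj (i j) (hij : i ≠ j) : x i ≠ x j := fun h => hij (hp i j h (by
    apply mul_left_cancel₀ (hx i)
    linear_combination -h2 i / 2 + h2 j / 2 - h * y j))
  have hroot (i) : x i ^ 4 + (-4 * c) * x i ^ 3 + (4 * c ^ 2 - a) * x i ^ 2
      + (4 * a * c) * x i + (-4 * a * c ^ 2 - b ^ 2 / 4) = 0 := by
    rw [← h1 i, ← h2 i]; ring
  have key (i j k l : Fin 4) (hij : i ≠ j) (hik : i ≠ k) (hil : i ≠ l) (hjk : j ≠ k)
      (hjl : j ≠ l) (hkl : k ≠ l) :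
      1 / (-4 * x i ^ 2 + 8 * c * x i - 4 * y i ^ 2) =
        -(x i - 2 * c) / (2 * ((x i - x j) * (x i - x k) * (x i - x l))) := by
    have h := quartic_derivative_at_root (hinj i j hij) (hinj i k hik) (hinj i l hil)
      (hinj j k hjk) (hinj j l hjl) (hinj k l hkl) (hroot i) (hroot j) (hroot k) (hroot l)
    have hn : (x i - x j) * (x i - x k) * (x i - x l) ≠ 0 :=
      mul_ne_zero (mul_ne_zero (sub_ne_zero.2 (hinj i j hij)) (sub_ne_zero.2 (hinj i k hik)))
        (sub_ne_zero.2 (hinj i l hil))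
    have hJ : (-4 * x i ^ 2 + 8 * c * x i - 4 * y i ^ 2) * -(x i - 2 * c) =
        2 * ((x i - x j) * (x i - x k) * (x i - x l)) := by
      rw [← h, ← h1 i]; ring
    have hJ0 : -4 * x i ^ 2 + 8 * c * x i - 4 * y i ^ 2 ≠ 0 := by
      intro h0
      rw [h0, zero_mul] at hJ
      exact hn (by linarith)
    rw [← hJ, div_eq_div_iff hJ0 (mul_ne_zero hJ0 (neg_ne_zero.2 (hx i)))]
    ring
  rw [Fin.sum_univ_four, key 0 1 2 3 (by decide) (by decide) (by decide) (by decide)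
    (by decide) (by decide), key 1 0 2 3 (by decide) (by decide) (by decide) (by decide)
    (by decide) (by decide), key 2 0 1 3 (by decide) (by decide) (by decide) (by decide)
    (by decide) (by decide), key 3 0 1 2 (by decide) (by decide) (by decide) (by decide)
    (by decide) (by decide)]
  have h01 := sub_ne_zero.2 (hinj 0 1 (by decide))
  have h02 := sub_ne_zero.2 (hinj 0 2 (by decide))
  have h03 := sub_ne_zero.2 (hinj 0 3 (by decide))
  have h12 := sub_ne_zero.2 (hinj 1 2 (by decide))
  have h13 := sub_ne_zero.2 (hinj 1 3 (by decide))
  have h23 := sub_ne_zero.2 (hinj 2 3 (by decide))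
  rw [← neg_sub (x 0) (x 1), ← neg_sub (x 0) (x 2), ← neg_sub (x 0) (x 3),
    ← neg_sub (x 1) (x 2), ← neg_sub (x 1) (x 3), ← neg_sub (x 2) (x 3)]
  field_simp
  ring

/-- The magnification relation on the axis `b = 0`. -/
lemma sum_inv_jacobian_of_eq_zero {c a : ℝ} {x y : Fin 4 → ℝ}
    (hp : ∀ i j, x i = x j → y i = y j → i = j)
    (h1 : ∀ i, x i ^ 2 - y i ^ 2 = a) (h2 : ∀ i, -2 * x i * y i + 4 * c * y i = 0)
    (hJ : ∀ i, -4 * x i ^ 2 + 8 * c * x i - 4 * y i ^ 2 ≠ 0) :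
    ∑ i, 1 / (-4 * x i ^ 2 + 8 * c * x i - 4 * y i ^ 2) = 0 := by
  have hcase (i) : y i = 0 ∨ x i = 2 * c := by
    have h : y i * (x i - 2 * c) = 0 := by linear_combination -h2 i / 2
    exact (mul_eq_zero.1 h).imp_right sub_eq_zero.1
  have hneg_x (i j) (hij : i ≠ j) (hi : y i = 0) (hj : y j = 0) : x j = -x i := by
    have h : x j ^ 2 = x i ^ 2 := by
      have hi1 := h1 i
      have hj1 := h1 j
      rw [hi] at hi1
      rw [hj] at hj1
      linarith
    exact (sq_eq_sq_iff_eq_or_eq_neg.1 h).resolve_left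
      fun h => hij (hp i j h.symm (hi.trans hj.symm))
  have hneg_y (i j) (hij : i ≠ j) (hi : x i = 2 * c) (hj : x j = 2 * c) : y j = -y i := by
    have h : y j ^ 2 = y i ^ 2 := by
      have hi1 := h1 i
      have hj1 := h1 j
      rw [hi] at hi1
      rw [hj] at hj1
      linarith
    exact (sq_eq_sq_iff_eq_or_eq_neg.1 h).resolve_left
      fun h => hij (hp i j (hi.trans hj.symm) h.symm)
  have three_y (i j k) (hij : i ≠ j) (hik : i ≠ k) (hjk : j ≠ k)
      (hi : y i = 0) (hj : y j = 0) (hk : y k = 0) : False :=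
    hjk (hp j k ((hneg_x i j hij hi hj).trans (hneg_x i k hik hi hk).symm) (hj.trans hk.symm))
  have three_x (i j k) (hij : i ≠ j) (hik : i ≠ k) (hjk : j ≠ k)
      (hi : x i = 2 * c) (hj : x j = 2 * c) (hk : x k = 2 * c) : False :=
    hjk (hp j k (hj.trans hk.symm) ((hneg_y i j hij hi hj).trans (hneg_y i k hik hi hk).symm))
  have two_two (i j k l) (hij : i ≠ j) (hkl : k ≠ l) (hi : y i = 0) (hj : y j = 0)
      (hk : x k = 2 * c) (hl : x l = 2 * c) :
      1 / (-4 * x i ^ 2 + 8 * c * x i - 4 * y i ^ 2)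
        + 1 / (-4 * x j ^ 2 + 8 * c * x j - 4 * y j ^ 2)
        + 1 / (-4 * x k ^ 2 + 8 * c * x k - 4 * y k ^ 2)
        + 1 / (-4 * x l ^ 2 + 8 * c * x l - 4 * y l ^ 2) = 0 := by
    have hJi := hJ i
    have hJj := hJ j
    have hxx := hneg_x i j hij hi hj
    have hyy := hneg_y k l hkl hk hl
    have hy : y k ^ 2 = (2 * c - x i) * (2 * c + x i) := by
      have hi1 := h1 i
      have hk1 := h1 k
      rw [hi] at hi1
      rw [hk] at hk1
      linarith
    rw [hi] at hJi
    rw [hj, hxx] at hJj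
    have hx : x i ≠ 0 := fun h => hJi (by rw [h]; ring)
    have hm : 2 * c - x i ≠ 0 := fun h => hJi (by linear_combination 4 * x i * h)
    have hq : 2 * c + x i ≠ 0 := fun h => hJj (by linear_combination -4 * x i * h)
    have ei : -4 * x i ^ 2 + 8 * c * x i - 4 * 0 ^ 2 = 4 * (x i * (2 * c - x i)) := by ring
    have ej : -4 * (-x i) ^ 2 + 8 * c * -x i - 4 * 0 ^ 2 = -4 * (x i * (2 * c + x i)) := by
      ring
    have ek : -4 * (2 * c) ^ 2 + 8 * c * (2 * c) - 4 * ((2 * c - x i) * (2 * c + x i))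
        = -4 * ((2 * c - x i) * (2 * c + x i)) := by ring
    rw [hi, hj, hk, hl, hxx, hyy, neg_sq (y k), hy, ei, ej, ek]
    field_simp
    ring
  rw [Fin.sum_univ_four]
  rcases hcase 0 with h0 | h0 <;> rcases hcase 1 with h1' | h1' <;>
    rcases hcase 2 with h2' | h2' <;> rcases hcase 3 with h3 | h3 <;>
  first
  | exact (three_y 0 1 2 (by decide) (by decide) (by decide) h0 h1' h2').elim
  | exact (three_y 0 1 3 (by decide) (by decide) (by decide) h0 h1' h3).elim
  | exact (three_y 0 2 3 (by decide) (by decide) (by decide) h0 h2' h3).elim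
  | exact (three_y 1 2 3 (by decide) (by decide) (by decide) h1' h2' h3).elim
  | exact (three_x 0 1 2 (by decide) (by decide) (by decide) h0 h1' h2').elim
  | exact (three_x 0 1 3 (by decide) (by decide) (by decide) h0 h1' h3).elim
  | exact (three_x 0 2 3 (by decide) (by decide) (by decide) h0 h2' h3).elim
  | exact (three_x 1 2 3 (by decide) (by decide) (by decide) h1' h2' h3).elim
  | linarith [two_two 0 1 2 3 (by decide) (by decide) h0 h1' h2' h3]
  | linarith [two_two 0 2 1 3 (by decide) (by decide) h0 h2' h1' h3]
  | linarith [two_two 0 3 1 2 (by decide) (by decide) h0 h3 h1' h2']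
  | linarith [two_two 1 2 0 3 (by decide) (by decide) h1' h2' h0 h3]
  | linarith [two_two 1 3 0 2 (by decide) (by decide) h1' h3 h0 h2']
  | linarith [two_two 2 3 0 1 (by decide) (by decide) h2' h3 h0 h1']

/-- Elliptic umbilic (D₄⁻) magnification relation in the four-image region. -/
theorem elliptic_umbilic_magnification_relation (c : ℝ) (s : ℝ × ℝ)
    (η : ℝ × ℝ → ℝ × ℝ)
    (hη : ∀ x y : ℝ, η (x, y) = (x ^ 2 - y ^ 2, -2 * x * y + 4 * c * y))
    (J : ℝ × ℝ → ℝ)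
    (hJ : ∀ x y : ℝ, J (x, y) =
      deriv (fun t => (η (t, y)).1) x * deriv (fun t => (η (x, t)).2) y -
      deriv (fun t => (η (x, t)).1) y * deriv (fun t => (η (t, y)).2) x)
    (p : Fin 4 → ℝ × ℝ) (hp : Function.Injective p)
    (hpre : η ⁻¹' {s} = Set.range p)
    (hnc : ∀ i, J (p i) ≠ 0) :
    ∑ i, 1 / J (p i) = 0 := by
  have hJ' (q : ℝ × ℝ) : J q = -4 * q.1 ^ 2 + 8 * c * q.1 - 4 * q.2 ^ 2 := by
    obtain ⟨x, y⟩ := q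
    rw [hJ]
    simp only [hη]
    have d1 : HasDerivAt (fun t : ℝ => t ^ 2 - y ^ 2) (2 * x) x := by
      simpa using (hasDerivAt_pow 2 x).sub_const (y ^ 2)
    have d2 : HasDerivAt (fun t : ℝ => -2 * x * t + 4 * c * t) (-2 * x + 4 * c) y := by
      simpa using ((hasDerivAt_id y).const_mul (-2 * x)).fun_add
        ((hasDerivAt_id y).const_mul (4 * c))
    have d3 : HasDerivAt (fun t : ℝ => x ^ 2 - t ^ 2) (-(2 * y)) y := by
      simpa using (hasDerivAt_pow 2 y).const_sub (x ^ 2)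
    have d4 : HasDerivAt (fun t : ℝ => -2 * t * y + 4 * c * y) (-2 * y) x := by
      simpa using (((hasDerivAt_id x).const_mul (-2)).mul_const y).add_const (4 * c * y)
    rw [d1.deriv, d2.deriv, d3.deriv, d4.deriv]
    ring
  have hs (i) : η ((p i).1, (p i).2) = s := by
    have : p i ∈ η ⁻¹' {s} := hpre ▸ Set.mem_range_self i
    exact this
  simp only [hη] at hs
  simp only [hJ'] at hnc ⊢
  have hinj (i j) (h1 : (p i).1 = (p j).1) (h2 : (p i).2 = (p j).2) : i = j :=
    hp (Prod.ext h1 h2)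
  have hs1 (i) : (p i).1 ^ 2 - (p i).2 ^ 2 = s.1 := congrArg Prod.fst (hs i)
  have hs2 (i) : -2 * (p i).1 * (p i).2 + 4 * c * (p i).2 = s.2 := congrArg Prod.snd (hs i)
  by_cases hb : s.2 = 0
  · exact sum_inv_jacobian_of_eq_zero hinj hs1 (fun i => (hs2 i).trans hb) hnc
  · exact sum_inv_jacobian_of_ne_zero hb hinj hs1 hs2
end

section
/- Let c ∈ ℝ. Define the hyperbolic umbilic (D₄⁺) lensing map η : ℝ² → ℝ² by η(x,y) = (x² + 2cy, y² + 2cx). If s ∈ ℝ² is a target point whose preimage set η⁻¹(s) consists of exactly 4 distinct points (x₁,y₁),…,(x₄,y₄), and J_η(x_i,y_i) ≠ 0 for every i (s is non-caustic), then the total signed magnification vanishes: Σ_{i=1}^{4} 1/J_η(x_i,y_i) = 0. -/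
/-- At a root `a` of a depressed monic quartic with four distinct roots, the derivative is the
product of the differences between `a` and the other roots. -/
lemma depressed_quartic_derivative_eq {p q r a b c d : ℝ}
    (hab : a ≠ b) (hac : a ≠ c) (had : a ≠ d) (hbc : b ≠ c) (hbd : b ≠ d) (hcd : c ≠ d)
    (ha : a ^ 4 + p * a ^ 2 + q * a + r = 0) (hb : b ^ 4 + p * b ^ 2 + q * b + r = 0)
    (hc : c ^ 4 + p * c ^ 2 + q * c + r = 0) (hd : d ^ 4 + p * d ^ 2 + q * d + r = 0) :
    4 * a ^ 3 + 2 * p * a + q = (a - b) * (a - c) * (a - d) := by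
  have first : ∀ u v : ℝ, u ≠ v → u ^ 4 + p * u ^ 2 + q * u + r = 0 →
      v ^ 4 + p * v ^ 2 + q * v + r = 0 → (u + v) * (u ^ 2 + v ^ 2 + p) + q = 0 :=
    fun u v h hu hv => mul_left_cancel₀ (sub_ne_zero.2 h) (by linear_combination hu - hv)
  have second : ∀ w : ℝ, b ≠ w → (a + b) * (a ^ 2 + b ^ 2 + p) + q = 0 →
      (a + w) * (a ^ 2 + w ^ 2 + p) + q = 0 →
      a ^ 2 + b ^ 2 + w ^ 2 + a * b + b * w + w * a + p = 0 :=
    fun w h h₁ h₂ => mul_left_cancel₀ (sub_ne_zero.2 h) (by linear_combination h₁ - h₂)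
  have eab := first a b hab ha hb
  have eabc := second c hbc eab (first a c hac ha hc)
  have eabd := second d hbd eab (first a d had ha hd)
  have sum_zero : a + b + c + d = 0 :=
    mul_left_cancel₀ (sub_ne_zero.2 hcd) (by linear_combination eabc - eabd)
  obtain rfl : d = -a - b - c := by linear_combination sum_zero
  linear_combination eab + (a - b) * eabc

/-- The reciprocals of the derivatives at four distinct roots of a depressed monic quartic sum to
zero. -/
lemma sum_inv_depressed_quartic_derivative {p q r : ℝ} (x : Fin 4 → ℝ)
    (hx : Function.Injective x) (h : ∀ i, x i ^ 4 + p * x i ^ 2 + q * x i + r = 0) :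
    ∑ i, 1 / (4 * x i ^ 3 + 2 * p * x i + q) = 0 := by
  have ne : ∀ i j : Fin 4, i ≠ j → x i ≠ x j := fun i j hij => hx.ne hij
  have h01 := ne 0 1 (by decide)
  have h02 := ne 0 2 (by decide)
  have h03 := ne 0 3 (by decide)
  have h12 := ne 1 2 (by decide)
  have h13 := ne 1 3 (by decide)
  have h23 := ne 2 3 (by decide)
  rw [Fin.sum_univ_four,
    depressed_quartic_derivative_eq h01 h02 h03 h12 h13 h23 (h 0) (h 1) (h 2) (h 3),
    depressed_quartic_derivative_eq h01.symm h12 h13 h02 h03 h23 (h 1) (h 0) (h 2) (h 3),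
    depressed_quartic_derivative_eq h02.symm h12.symm h23 h01 h03 h13 (h 2) (h 0) (h 1) (h 3),
    depressed_quartic_derivative_eq h03.symm h13.symm h23.symm h01 h02 h12
      (h 3) (h 0) (h 1) (h 2)]
  generalize x 0 = a at *
  generalize x 1 = b at *
  generalize x 2 = c at *
  generalize x 3 = d at *
  have := sub_ne_zero.2 h01
  have := sub_ne_zero.2 h02
  have := sub_ne_zero.2 h03
  have := sub_ne_zero.2 h12
  have := sub_ne_zero.2 h13
  have := sub_ne_zero.2 h23
  rw [← neg_sub a b, ← neg_sub a c, ← neg_sub a d, ← neg_sub b c, ← neg_sub b d, ← neg_sub c d]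
  field_simp
  ring


/-- Hyperbolic umbilic (D₄⁺) magnification relation in the four-image region. -/
theorem hyperbolic_umbilic_magnification_relation (c : ℝ) (s : ℝ × ℝ)
    (η : ℝ × ℝ → ℝ × ℝ)
    (hη : ∀ x y : ℝ, η (x, y) = (x ^ 2 + 2 * c * y, y ^ 2 + 2 * c * x))
    (J : ℝ × ℝ → ℝ)
    (hJ : ∀ x y : ℝ, J (x, y) =
      deriv (fun t => (η (t, y)).1) x * deriv (fun t => (η (x, t)).2) y -
      deriv (fun t => (η (x, t)).1) y * deriv (fun t => (η (t, y)).2) x)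
    (p : Fin 4 → ℝ × ℝ) (hp : Function.Injective p)
    (hpre : η ⁻¹' {s} = Set.range p)
    (hnc : ∀ i, J (p i) ≠ 0) :
    ∑ i, 1 / J (p i) = 0 := by
  have hJ' : ∀ z : ℝ × ℝ, J z = 4 * z.1 * z.2 - 4 * c ^ 2 := by
    rintro ⟨x, y⟩
    simp only [hJ, hη]
    have h₁ : ∀ x y : ℝ, deriv (fun t : ℝ => t ^ 2 + 2 * c * y) x = 2 * x := by
      intro x y
      simp
    have h₂ : ∀ x y : ℝ, deriv (fun t : ℝ => x ^ 2 + 2 * c * t) y = 2 * c := by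
      intro x y
      simp
    rw [h₁, h₁, h₂, h₂]
    ring
  have mem : ∀ z : ℝ × ℝ, z ∈ Set.range p ↔
      z.1 ^ 2 + 2 * c * z.2 = s.1 ∧ z.2 ^ 2 + 2 * c * z.1 = s.2 := by
    rintro ⟨x, y⟩
    rw [← hpre, Set.mem_preimage, Set.mem_singleton_iff, hη, Prod.ext_iff]
  have hpi : ∀ i, _ := fun i => (mem (p i)).1 ⟨i, rfl⟩
  by_cases hc : c = 0
  · subst hc
    have hx : ∀ i, (p i).1 ≠ 0 := fun i h => hnc i (by simp [hJ', h])
    rw [← Finset.sum_image (s := Finset.univ) (f := fun z => 1 / J z) hp.injOn]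
    refine Finset.sum_involution (fun z _ => (-z.1, z.2)) ?_ ?_ ?_ ?_
    · intro z _
      simp only [hJ']
      rw [show 4 * -z.1 * z.2 - 4 * (0 : ℝ) ^ 2 = -(4 * z.1 * z.2 - 4 * 0 ^ 2) by ring,
        div_neg, add_neg_cancel]
    · intro z hz _ h
      obtain ⟨i, -, rfl⟩ := Finset.mem_image.1 hz
      exact hx i (by linarith [congrArg Prod.fst h])
    · intro z hz
      obtain ⟨i, -, rfl⟩ := Finset.mem_image.1 hz
      obtain ⟨j, hj⟩ := (mem (-(p i).1, (p i).2)).2 (by simpa using hpi i)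
      exact Finset.mem_image.2 ⟨j, Finset.mem_univ j, hj⟩
    · intro z _
      simp
  · have hx : Function.Injective fun i => (p i).1 := by
      intro i j (hij : (p i).1 = (p j).1)
      refine hp (Prod.ext hij (mul_left_cancel₀ (mul_ne_zero two_ne_zero hc) ?_))
      have := (hpi i).1
      rw [hij] at this
      linarith [(hpi j).1]
    have key := sum_inv_depressed_quartic_derivative (p := -2 * s.1) (q := 8 * c ^ 3)
      (r := s.1 ^ 2 - 4 * c ^ 2 * s.2) _ hx fun i => by
        rw [← (hpi i).1, ← (hpi i).2]
        ring
    have hterm : ∀ i, 1 / J (p i) =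
        -2 * c * (1 / (4 * (p i).1 ^ 3 + 2 * (-2 * s.1) * (p i).1 + 8 * c ^ 3)) := by
      intro i
      have hd : 4 * (p i).1 ^ 3 + 2 * (-2 * s.1) * (p i).1 + 8 * c ^ 3 = -2 * c * J (p i) := by
        rw [hJ', ← (hpi i).1]
        ring
      have := hnc i
      rw [hd]
      field_simp
    rw [Finset.sum_congr rfl fun i _ => hterm i, ← Finset.mul_sum, key, mul_zero]
end

section
/- Let ε ∈ {1,−1} be a sign and c₁, c₂, c₃ ∈ ℂ. Define the complexified E₆ map f : ℂ² → ℂ² by f(x,y) = (3x² + c₃y² + c₁y, 4εy³ + 2c₃xy + 2c₂y + c₁x). If s ∈ ℂ² is non-caustic, i.e., J_f(x,y) ≠ 0 for every (x,y) ∈ f⁻¹(s), then the fiber f⁻¹(s) is a finite set and Σ_{(x,y) ∈ f⁻¹(s)} 1/J_f(x,y) = 0. -/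
open Polynomial in
/-- **Euler–Jacobi vanishing in one variable.** If `R` has only simple roots and the degree of `N`
is at most `deg R - 2`, then the residues of `N / R` sum to zero. -/
theorem sum_eval_div_eval_derivative_eq_zero {K : Type*} [Field K] [IsAlgClosed K] [DecidableEq K]
    {R N : K[X]} (hR : ∀ r, R.eval r = 0 → R.derivative.eval r ≠ 0)
    (hdeg : N.natDegree + 2 ≤ R.natDegree) :
    ∑ r ∈ R.roots.toFinset, N.eval r / R.derivative.eval r = 0 := by
  have hR0 : R ≠ 0 := by
    rintro rfl
    simp at hdeg
  have hsplit := IsAlgClosed.splits R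
  have hnodup : R.roots.Nodup := by
    rw [Multiset.nodup_iff_count_le_one]
    intro a
    rw [count_roots]
    by_contra! h
    obtain ⟨h0, h1⟩ := (one_lt_rootMultiplicity_iff_isRoot hR0).1 h
    exact hR a h0 h1
  have hcard : R.roots.toFinset.card = R.natDegree := by
    rw [Multiset.toFinset_card_of_nodup hnodup, hsplit.natDegree_eq_card_roots]
  have hprod : R = C R.leadingCoeff * Lagrange.nodal R.roots.toFinset id := by
    conv_lhs => rw [hsplit.eq_prod_roots]
    rw [Lagrange.nodal_eq, Finset.prod, Multiset.toFinset_val, hnodup.dedup]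
    rfl
  have key := Lagrange.coeff_eq_sum (s := R.roots.toFinset) (v := id)
    (Function.injective_id.injOn) (P := N)
    (degree_le_natDegree.trans_lt (by rw [hcard]; exact_mod_cast (by omega)))
  rw [coeff_eq_zero_of_natDegree_lt (by omega)] at key
  have hterm : ∀ r ∈ R.roots.toFinset, N.eval r / R.derivative.eval r =
      R.leadingCoeff⁻¹ *
        (N.eval (id r) / ∏ j ∈ R.roots.toFinset.erase r, (id r - id j)) := by
    intro r hr
    have h : R.derivative.eval r =
        R.leadingCoeff * ∏ j ∈ R.roots.toFinset.erase r, (id r - id j) := by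
      conv_lhs => rw [hprod]
      rw [derivative_C_mul, eval_C_mul]
      congr 1
      exact (Lagrange.eval_nodal_derivative_eval_node_eq (v := id) hr).trans Lagrange.eval_nodal
    rw [h, id, div_mul_eq_div_div, div_eq_inv_mul, div_eq_inv_mul, div_eq_inv_mul]
    ring
  rw [Finset.sum_congr rfl hterm, ← Finset.mul_sum, ← key, mul_zero]

open Polynomial in
/-- The fibre sum when the equation linear in `x` determines `x` at every point of the fibre. -/
theorem fibre_sum_of_no_common_root {ε c₁ c₂ c₃ s₁ s₂ : ℂ} (hε : ε ≠ 0) {S : Set (ℂ × ℂ)}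
    {J : ℂ × ℂ → ℂ}
    (hS : ∀ x y : ℂ, (x, y) ∈ S ↔ 3 * x ^ 2 + c₃ * y ^ 2 + c₁ * y = s₁ ∧
      4 * ε * y ^ 3 + 2 * c₃ * x * y + 2 * c₂ * y + c₁ * x = s₂)
    (hJ : ∀ x y : ℂ, J (x, y) =
      6 * x * (12 * ε * y ^ 2 + 2 * c₃ * x + 2 * c₂) - (2 * c₃ * y + c₁) ^ 2)
    (hnc : ∀ q ∈ S, J q ≠ 0)
    (hL : ∀ y, 2 * c₃ * y + c₁ = 0 → s₂ - 2 * c₂ * y - 4 * ε * y ^ 3 ≠ 0) :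
    S.Finite ∧ ∑ᶠ q ∈ S, 1 / J q = 0 := by
  classical
  set L : ℂ[X] := C (2 * c₃) * X + C c₁ with hLdef
  set R : ℂ[X] := C 3 * (C s₂ - C (2 * c₂) * X - C (4 * ε) * X ^ 3) ^ 2 +
    (C c₃ * X ^ 2 + C c₁ * X - C s₁) * (C (2 * c₃) * X + C c₁) ^ 2 with hRdef
  have hLev : ∀ y, L.eval y = 2 * c₃ * y + c₁ := fun y => by simp [hLdef]
  have hRev : ∀ y, R.eval y = 3 * (s₂ - 2 * c₂ * y - 4 * ε * y ^ 3) ^ 2 +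
      (c₃ * y ^ 2 + c₁ * y - s₁) * (2 * c₃ * y + c₁) ^ 2 := fun y => by simp [hRdef]
  have hRdeg : R.natDegree = 6 := by
    rw [hRdef]
    compute_degree!
  have hLdeg : L.natDegree ≤ 1 := by
    rw [hLdef]
    compute_degree
  have hL0 : ∀ y, R.eval y = 0 → 2 * c₃ * y + c₁ ≠ 0 := by
    intro y hy h
    rw [hRev, h] at hy
    exact hL y h (by simpa using hy)
  set g : ℂ → ℂ × ℂ := fun y => ((s₂ - 2 * c₂ * y - 4 * ε * y ^ 3) / (2 * c₃ * y + c₁), y) with hg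
  have hR0 : R ≠ 0 := by
    rintro h
    simp [h] at hRdeg
  have hquot : ∀ y, R.eval y = 0 → ∃ x, g y = (x, y) ∧
      x * (2 * c₃ * y + c₁) = s₂ - 2 * c₂ * y - 4 * ε * y ^ 3 ∧
      3 * x ^ 2 + c₃ * y ^ 2 + c₁ * y = s₁ := by
    intro y hy
    have h0 := hL0 y hy
    have hx := div_mul_cancel₀ (s₂ - 2 * c₂ * y - 4 * ε * y ^ 3) h0
    refine ⟨_, rfl, hx, mul_left_cancel₀ (pow_ne_zero 2 h0) ?_⟩
    rw [hRev, ← hx] at hy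
    linear_combination hy
  have hSF : S = ↑(R.roots.toFinset.image g) := by
    ext ⟨x, y⟩
    simp only [hS, Finset.coe_image, Set.mem_image, Finset.mem_coe, Multiset.mem_toFinset,
      mem_roots hR0, IsRoot.def]
    constructor
    · rintro ⟨h1, h2⟩
      have hM : s₂ - 2 * c₂ * y - 4 * ε * y ^ 3 = x * (2 * c₃ * y + c₁) := by
        linear_combination -h2
      refine ⟨y, ?_, Prod.ext ?_ rfl⟩
      · rw [hRev, hM]
        linear_combination (2 * c₃ * y + c₁) ^ 2 * h1
      · simp only [hg]
        rw [hM, mul_div_cancel_right₀]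
        intro h
        exact hL y h (by rw [hM, h, mul_zero])
    · rintro ⟨y', hy, he⟩
      obtain ⟨x', hgx, h2, h1⟩ := hquot y' hy
      rw [hgx] at he
      cases he
      exact ⟨h1, by linear_combination h2⟩
  have hder : ∀ y, R.eval y = 0 → R.derivative.eval y = -(2 * c₃ * y + c₁) * J (g y) := by
    intro y hy
    obtain ⟨x, hgx, h2, h1⟩ := hquot y hy
    rw [hgx, hJ]
    simp only [hRdef, derivative_add, derivative_sub, derivative_mul, derivative_C, derivative_X,
      derivative_pow, eval_add, eval_sub, eval_mul, eval_pow, eval_C, eval_X, eval_zero, eval_one]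
    push_cast
    linear_combination 6 * (2 * c₂ + 12 * ε * y ^ 2) * h2 + 4 * c₃ * (2 * c₃ * y + c₁) * h1
  refine ⟨hSF ▸ Finset.finite_toSet _, ?_⟩
  have hmem : ∀ y, R.eval y = 0 → g y ∈ S := by
    intro y hy
    rw [hSF]
    exact Finset.mem_coe.2 (Finset.mem_image_of_mem _ (by simpa [hR0] using hy))
  rw [hSF, finsum_mem_coe_finset, Finset.sum_image (fun a _ b _ h => congrArg Prod.snd h)]
  rw [← neg_eq_zero, ← Finset.sum_neg_distrib, ← sum_eval_div_eval_derivative_eq_zero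
    (R := R) (N := L) (fun y hy => by
      rw [hder y hy]
      exact mul_ne_zero (neg_ne_zero.2 (hL0 y hy)) (hnc _ (hmem y hy))) (by omega)]
  refine Finset.sum_congr rfl fun y hy => ?_
  replace hy : R.eval y = 0 := by simpa [hR0] using hy
  have h0 := hL0 y hy
  have h1 := hnc _ (hmem y hy)
  rw [hder y hy, hLev]
  field_simp

open Polynomial in
/-- The fibre sum when the two equations decouple. -/
theorem fibre_sum_of_decoupled {ε c₂ s₁ s₂ : ℂ} (hε : ε ≠ 0) {S : Set (ℂ × ℂ)}
    {J : ℂ × ℂ → ℂ}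
    (hS : ∀ x y : ℂ, (x, y) ∈ S ↔ 3 * x ^ 2 = s₁ ∧ 4 * ε * y ^ 3 + 2 * c₂ * y = s₂)
    (hJ : ∀ x y : ℂ, J (x, y) = 6 * x * (12 * ε * y ^ 2 + 2 * c₂)) :
    S.Finite ∧ ∑ᶠ q ∈ S, 1 / J q = 0 := by
  classical
  set M : ℂ[X] := C (4 * ε) * X ^ 3 + C (2 * c₂) * X - C s₂ with hM
  have hM0 : M ≠ 0 := by
    have : M.natDegree = 3 := by
      rw [hM]
      compute_degree!
    rintro h
    simp [h] at this
  obtain ⟨a, ha⟩ := IsAlgClosed.exists_pow_nat_eq (s₁ / 3) (n := 2) (by norm_num)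
  have hSF : S = ↑(({a, -a} : Finset ℂ) ×ˢ M.roots.toFinset) := by
    ext ⟨x, y⟩
    have hx : 3 * x ^ 2 = s₁ ↔ x = a ∨ x = -a := by
      rw [← sq_eq_sq_iff_eq_or_eq_neg, ha, eq_div_iff (by norm_num), mul_comm]
    rw [hS, hx]
    have hy : 4 * ε * y ^ 3 + 2 * c₂ * y = s₂ ↔ y ∈ M.roots.toFinset := by
      rw [Multiset.mem_toFinset, mem_roots hM0, IsRoot.def, hM]
      simp [sub_eq_zero]
    rw [hy]
    simp
  refine ⟨hSF ▸ Finset.finite_toSet _, ?_⟩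
  rw [hSF, finsum_mem_coe_finset, Finset.sum_product_right]
  refine Finset.sum_eq_zero fun y _ => ?_
  by_cases h : a = 0
  · simp [h, hJ]
  · rw [Finset.sum_pair (fun h' => h (self_eq_neg.1 h')), hJ, hJ]
    rw [mul_neg, neg_mul, div_neg, add_neg_cancel]

open Polynomial in
/-- The fibre sum when the second equation factors as `2 c₃ (y - b) (x - k y) = 0` with `k` a
quadratic polynomial. -/
theorem fibre_sum_of_common_root {c₁ c₃ s₁ b k₀ k₁ k₂ : ℂ} (hc₃ : c₃ ≠ 0) (hk₂ : k₂ ≠ 0)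
    {S : Set (ℂ × ℂ)} {J : ℂ × ℂ → ℂ}
    (hS : ∀ x y : ℂ, (x, y) ∈ S ↔ 3 * x ^ 2 + c₃ * y ^ 2 + c₁ * y = s₁ ∧
      2 * c₃ * (y - b) * (x - (k₂ * y ^ 2 + k₁ * y + k₀)) = 0)
    (hJ : ∀ x y : ℂ, J (x, y) =
      6 * x * (2 * c₃ * (x - (k₂ * y ^ 2 + k₁ * y + k₀)) - 2 * c₃ * (y - b) * (2 * k₂ * y + k₁)) -
        (2 * c₃ * y + c₁) * (2 * c₃ * (y - b)))
    (hnc : ∀ q ∈ S, J q ≠ 0) :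
    S.Finite ∧ ∑ᶠ q ∈ S, 1 / J q = 0 := by
  classical
  set T : ℂ[X] := C 3 * (C k₂ * X ^ 2 + C k₁ * X + C k₀) ^ 2 +
    (C c₃ * X ^ 2 + C c₁ * X - C s₁) with hT
  have hTev : ∀ y, T.eval y = 3 * (k₂ * y ^ 2 + k₁ * y + k₀) ^ 2 +
      (c₃ * y ^ 2 + c₁ * y - s₁) := fun y => by simp [hT]
  have hTdeg : T.natDegree = 4 := by
    rw [hT]
    compute_degree!
  have hT0 : T ≠ 0 := by
    rintro h
    simp [h] at hTdeg
  set k : ℂ → ℂ := fun y => k₂ * y ^ 2 + k₁ * y + k₀ with hk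
  set g : ℂ → ℂ × ℂ := fun y => (k y, y) with hg
  have hder : ∀ y, J (g y) = -(2 * c₃ * (y - b)) * T.derivative.eval y := by
    intro y
    rw [hg, hJ]
    simp only [hT, hk, derivative_add, derivative_sub, derivative_mul, derivative_C, derivative_X,
      derivative_pow, eval_add, eval_sub, eval_mul, eval_pow, eval_C, eval_X, eval_zero, eval_one]
    push_cast
    ring
  have hmem : ∀ y, T.eval y = 0 → g y ∈ S := by
    intro y hy
    rw [hTev] at hy
    rw [hg, hS]
    exact ⟨by linear_combination hy, by simp [hk]⟩
  have hb : ∀ y, T.eval y = 0 → y ≠ b ∧ T.derivative.eval y ≠ 0 := by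
    intro y hy
    have h := hnc _ (hmem y hy)
    rw [hder] at h
    constructor
    · rintro rfl
      simp at h
    · intro h'
      simp [h'] at h
  have hTb : T.eval b ≠ 0 := fun h => (hb b h).1 rfl
  obtain ⟨a, ha⟩ := IsAlgClosed.exists_pow_nat_eq ((s₁ - c₃ * b ^ 2 - c₁ * b) / 3) (n := 2)
    (by norm_num)
  rw [eq_div_iff (by norm_num)] at ha
  have hab : ∀ x, x = a ∨ x = -a → (x, b) ∈ S := by
    intro x hx
    rw [← sq_eq_sq_iff_eq_or_eq_neg] at hx
    rw [hS]
    exact ⟨by linear_combination ha + 3 * hx, by simp⟩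
  have hJa := hnc _ (hab a (.inl rfl))
  have hJa' := hnc _ (hab (-a) (.inr rfl))
  have ha0 : a ≠ 0 := by
    rintro rfl
    exact hJa (by rw [hJ]; ring)
  have hSF : S = ↑((({a, -a} : Finset ℂ).image fun x => (x, b)) ∪ T.roots.toFinset.image g) := by
    ext ⟨x, y⟩
    constructor
    · intro h
      obtain ⟨h1, h2⟩ := (hS x y).1 h
      rcases mul_eq_zero.1 h2 with h3 | h3
      · have hy : y = b := by simpa [hc₃, sub_eq_zero] using h3
        subst hy
        have hx : x = a ∨ x = -a := by
          rw [← sq_eq_sq_iff_eq_or_eq_neg]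
          linear_combination (h1 - ha) / 3
        rw [Finset.coe_union]
        exact Or.inl (Finset.mem_coe.2 (Finset.mem_image.2 ⟨x, by simpa using hx, rfl⟩))
      · have hx : x = k y := sub_eq_zero.1 h3
        have hy : T.eval y = 0 := by
          rw [hTev]
          rw [hx] at h1
          linear_combination h1
        rw [Finset.coe_union]
        refine Or.inr (Finset.mem_coe.2 (Finset.mem_image.2 ⟨y, by simpa [hT0] using hy, ?_⟩))
        rw [hg, hx]
    · intro h
      rcases Finset.mem_union.1 (Finset.mem_coe.1 h) with h | h
      · obtain ⟨x', hx', he⟩ := Finset.mem_image.1 h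
        rw [← he]
        exact hab x' (by simpa using hx')
      · obtain ⟨y', hy', he⟩ := Finset.mem_image.1 h
        rw [← he]
        exact hmem y' (by simpa [hT0] using hy')
  have hdisj : Disjoint (({a, -a} : Finset ℂ).image fun x => (x, b)) (T.roots.toFinset.image g) := by
    rw [Finset.disjoint_left]
    intro q h1 h2
    obtain ⟨x', -, he⟩ := Finset.mem_image.1 h1
    obtain ⟨y', hy', he'⟩ := Finset.mem_image.1 h2
    have : y' = b := congrArg Prod.snd (he'.trans he.symm)
    exact (hb y' (by simpa [hT0] using hy')).1 this
  refine ⟨hSF ▸ Finset.finite_toSet _, ?_⟩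
  rw [hSF, finsum_mem_coe_finset, Finset.sum_union hdisj,
    Finset.sum_image (fun x _ y _ h => congrArg Prod.fst h),
    Finset.sum_image (fun x _ y _ h => congrArg Prod.snd h),
    Finset.sum_pair (fun h => ha0 (self_eq_neg.1 h))]
  have hWdeg : ((X - C b) * T).natDegree = 5 := by
    rw [natDegree_mul (X_sub_C_ne_zero b) hT0, natDegree_X_sub_C, hTdeg]
  have hW0 : (X - C b) * T ≠ 0 := mul_ne_zero (X_sub_C_ne_zero b) hT0
  have hWder : ∀ y, ((X - C b) * T).derivative.eval y =
      T.eval y + (y - b) * T.derivative.eval y := by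
    intro y
    simp
  have hWroots : ((X - C b) * T).roots.toFinset = insert b T.roots.toFinset := by
    rw [roots_mul hW0, roots_X_sub_C]
    simp
  have key := sum_eval_div_eval_derivative_eq_zero (R := (X - C b) * T) (N := C 1)
    (fun y hy => by
      rw [hWder]
      rw [eval_mul, mul_eq_zero] at hy
      rcases hy with hy | hy
      · have : y = b := by simpa [sub_eq_zero] using hy
        subst this
        simpa using hTb
      · rw [hy, zero_add]
        exact mul_ne_zero (sub_ne_zero.2 (hb y hy).1) (hb y hy).2)
    (by rw [hWdeg, natDegree_C]; norm_num)
  rw [hWroots, Finset.sum_insert (by simpa [hT0] using hTb)] at key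
  have hterm : ∀ y ∈ T.roots.toFinset, 1 / J (g y) =
      -(1 / (2 * c₃)) * ((C 1 : ℂ[X]).eval y / ((X - C b) * T).derivative.eval y) := by
    intro y hy
    replace hy : T.eval y = 0 := by simpa [hT0] using hy
    obtain ⟨h1, h2⟩ := hb y hy
    replace h1 := sub_ne_zero.2 h1
    rw [hder, hWder, hy, eval_C]
    field_simp
    ring
  rw [Finset.sum_congr rfl hterm, ← Finset.mul_sum, eq_neg_of_add_eq_zero_right key, hWder]
  have hTab : T.eval b = 3 * (k b ^ 2 - a ^ 2) := by
    rw [hTev]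
    linear_combination ha
  have hja : J (a, b) = 12 * c₃ * a * (a - k b) := by
    rw [hJ]
    ring
  have hja' : J (-a, b) = 12 * c₃ * a * (a + k b) := by
    rw [hJ]
    ring
  rw [hja] at hJa ⊢
  rw [hja'] at hJa' ⊢
  have h1 := right_ne_zero_of_mul hJa
  have h2 := right_ne_zero_of_mul hJa'
  have hTab' : T.eval b = -(3 * ((a - k b) * (a + k b))) := by
    rw [hTab]
    ring
  rw [hTab', sub_self, zero_mul, add_zero, eval_C]
  field_simp
  ring

/-- Complexified E₆ magnification relation. -/
theorem E6_complex_magnification_relation (ε : ℂ) (hε : ε = 1 ∨ ε = -1)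
    (c₁ c₂ c₃ : ℂ) (s : ℂ × ℂ)
    (f : ℂ × ℂ → ℂ × ℂ)
    (hf : ∀ x y : ℂ, f (x, y) =
      (3 * x ^ 2 + c₃ * y ^ 2 + c₁ * y,
       4 * ε * y ^ 3 + 2 * c₃ * x * y + 2 * c₂ * y + c₁ * x))
    (J : ℂ × ℂ → ℂ)
    (hJ : ∀ x y : ℂ, J (x, y) =
      deriv (fun t => (f (t, y)).1) x * deriv (fun t => (f (x, t)).2) y -
      deriv (fun t => (f (x, t)).1) y * deriv (fun t => (f (t, y)).2) x)
    (hnc : ∀ q ∈ f ⁻¹' {s}, J q ≠ 0) :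
    (f ⁻¹' {s}).Finite ∧ ∑ᶠ q ∈ f ⁻¹' {s}, 1 / J q = 0 := by
  obtain ⟨s₁, s₂⟩ := s
  have hε0 : ε ≠ 0 := by rcases hε with rfl | rfl <;> norm_num
  have hS : ∀ x y : ℂ, (x, y) ∈ f ⁻¹' {(s₁, s₂)} ↔ 3 * x ^ 2 + c₃ * y ^ 2 + c₁ * y = s₁ ∧
      4 * ε * y ^ 3 + 2 * c₃ * x * y + 2 * c₂ * y + c₁ * x = s₂ := by
    intro x y
    simp [hf]
  have hJ' : ∀ x y : ℂ, J (x, y) =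
      6 * x * (12 * ε * y ^ 2 + 2 * c₃ * x + 2 * c₂) - (2 * c₃ * y + c₁) ^ 2 := by
    intro x y
    have h1 : HasDerivAt (fun t => (f (t, y)).1) (6 * x) x := by
      simp only [hf]
      convert! ((((hasDerivAt_id x).pow 2).const_mul 3).add_const (c₃ * y ^ 2)).add_const
        (c₁ * y) using 1
      simp
      ring
    have h2 : HasDerivAt (fun t => (f (x, t)).2) (12 * ε * y ^ 2 + 2 * c₃ * x + 2 * c₂) y := by
      simp only [hf]
      convert! (((((hasDerivAt_id y).pow 3).const_mul (4 * ε)).add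
        ((hasDerivAt_id y).const_mul (2 * c₃ * x))).add
        ((hasDerivAt_id y).const_mul (2 * c₂))).add_const (c₁ * x) using 1
      simp
      ring
    have h3 : HasDerivAt (fun t => (f (x, t)).1) (2 * c₃ * y + c₁) y := by
      simp only [hf]
      convert! ((((hasDerivAt_id y).pow 2).const_mul c₃).const_add (3 * x ^ 2)).add
        ((hasDerivAt_id y).const_mul c₁) using 1
      simp
      ring
    have h4 : HasDerivAt (fun t => (f (t, y)).2) (2 * c₃ * y + c₁) x := by
      simp only [hf]
      convert! (((((hasDerivAt_id x).const_mul (2 * c₃)).mul_const y).const_add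
        (4 * ε * y ^ 3)).add_const (2 * c₂ * y)).add
        ((hasDerivAt_id x).const_mul c₁) using 1
      simp
    rw [hJ, h1.deriv, h2.deriv, h3.deriv, h4.deriv]
    ring
  by_cases hL : ∀ y, 2 * c₃ * y + c₁ = 0 → s₂ - 2 * c₂ * y - 4 * ε * y ^ 3 ≠ 0
  · exact fibre_sum_of_no_common_root hε0 hS hJ' hnc hL
  push Not at hL
  obtain ⟨b, hb, hM⟩ := hL
  obtain rfl : c₁ = -(2 * c₃ * b) := by linear_combination hb
  by_cases hc₃ : c₃ = 0
  · subst hc₃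
    exact fibre_sum_of_decoupled (c₂ := c₂) (s₁ := s₁) (s₂ := s₂) hε0
      (fun x y => by simpa using hS x y) (fun x y => by simpa using hJ' x y)
  · obtain rfl : s₂ = 2 * c₂ * b + 4 * ε * b ^ 3 := by linear_combination hM
    refine fibre_sum_of_common_root (c₁ := -(2 * c₃ * b)) (s₁ := s₁) (b := b)
      (k₂ := -(2 * ε / c₃)) (k₁ := -(2 * ε * b / c₃)) (k₀ := -(2 * ε * b ^ 2 + c₂) / c₃) hc₃
      (by simp [hε0, hc₃]) (fun x y => ?_) (fun x y => ?_) hnc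
    · rw [hS, ← sub_eq_zero (b := 2 * c₂ * b + 4 * ε * b ^ 3)]
      have : 4 * ε * y ^ 3 + 2 * c₃ * x * y + 2 * c₂ * y + -(2 * c₃ * b) * x -
          (2 * c₂ * b + 4 * ε * b ^ 3) = 2 * c₃ * (y - b) * (x - (-(2 * ε / c₃) * y ^ 2 +
            -(2 * ε * b / c₃) * y + -(2 * ε * b ^ 2 + c₂) / c₃)) := by
        field_simp
        ring
      rw [this]
    · rw [hJ']
      field_simp
      ring
end

section
/- Let c₁, c₂, c₃, c₄ ∈ ℂ. Define the complexified E₇ map f : ℂ² → ℂ² by f(x,y) = (3x² + y³ + c₁y, 3xy² + 4c₄y³ + 3c₃y² + 2c₂y + c₁x). If s ∈ ℂ² is non-caustic, i.e., J_f(x,y) ≠ 0 for every (x,y) ∈ f⁻¹(s), then the fiber f⁻¹(s) is a finite set and Σ_{(x,y) ∈ f⁻¹(s)} 1/J_f(x,y) = 0. -/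
open Polynomial in
/-- The Euler–Jacobi vanishing relation in one variable. -/
theorem sum_eval_div_eval_derivative_roots {K : Type*} [Field K] [IsAlgClosed K] [DecidableEq K]
    {P Q : K[X]} (hdeg : P.natDegree + 2 ≤ Q.natDegree)
    (hQ : ∀ z ∈ Q.roots, Q.derivative.eval z ≠ 0) :
    ∑ z ∈ Q.roots.toFinset, P.eval z / Q.derivative.eval z = 0 := by
  have hQ0 : Q ≠ 0 := by rintro rfl; simp at hdeg
  have hsplit : Q.Splits := IsAlgClosed.splits Q
  have hnodup : Q.roots.Nodup := by
    rw [Multiset.nodup_iff_count_le_one]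
    intro z
    rw [count_roots]
    by_contra! h
    obtain ⟨h₁, h₂⟩ := (one_lt_rootMultiplicity_iff_isRoot hQ0).1 h
    exact hQ z ((mem_roots hQ0).2 h₁) h₂
  have hcard : Q.roots.toFinset.card = Q.natDegree := by
    rw [Multiset.toFinset_card_of_nodup hnodup, ← hsplit.natDegree_eq_card_roots]
  have hfactor : Q = C Q.leadingCoeff * Lagrange.nodal Q.roots.toFinset id := by
    conv_lhs => rw [hsplit.eq_prod_roots]
    rw [Lagrange.nodal_eq, Finset.prod, Multiset.toFinset_val, hnodup.dedup]
    rfl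
  have hcoeff := Lagrange.coeff_eq_sum (s := Q.roots.toFinset) (v := id)
    (Set.injOn_id _) (P := P) (by
      rw [hcard]
      exact degree_le_natDegree.trans_lt (by exact_mod_cast (by omega)))
  rw [coeff_eq_zero_of_natDegree_lt (by omega)] at hcoeff
  have hterm : ∀ z ∈ Q.roots.toFinset, P.eval z / Q.derivative.eval z =
      Q.leadingCoeff⁻¹ * (P.eval (id z) / ∏ w ∈ Q.roots.toFinset.erase z, (id z - id w)) := by
    intro z hz
    have h : Q.derivative.eval z =
        Q.leadingCoeff * ∏ w ∈ Q.roots.toFinset.erase z, (id z - id w) := by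
      conv_lhs => rw [hfactor]
      rw [derivative_C_mul, eval_C_mul, ← Lagrange.eval_nodal,
        ← Lagrange.eval_nodal_derivative_eval_node_eq hz]
      rfl
    rw [h, div_mul_eq_div_div_swap, div_eq_inv_mul _ Q.leadingCoeff, id]
  rw [Finset.sum_congr rfl hterm, ← Finset.mul_sum, ← hcoeff, mul_zero]

open Polynomial in
/-- Vanishing of the sum of inverse Jacobians over the solutions `(x, y)` of the system
`3 * x ^ 2 + C y = 0`, `A y * x + B y = 0`. -/
theorem finite_and_finsum_inv_jacobian_eq_zero {A B C : ℂ[X]} (hA : A ≠ 0)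
    (hC : 2 ≤ C.natDegree) (hB : 2 * B.natDegree < 2 * A.natDegree + C.natDegree)
    {S : Set (ℂ × ℂ)}
    (hS : ∀ q, q ∈ S ↔ 3 * q.1 ^ 2 + C.eval q.2 = 0 ∧ A.eval q.2 * q.1 + B.eval q.2 = 0)
    {J : ℂ × ℂ → ℂ}
    (hJ : ∀ x y, J (x, y) = 6 * x * (A.derivative.eval y * x + B.derivative.eval y) -
      C.derivative.eval y * A.eval y)
    (hJ0 : ∀ q ∈ S, J q ≠ 0) :
    S.Finite ∧ ∑ᶠ q ∈ S, 1 / J q = 0 := by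
  classical
  obtain ⟨g, A₁, B₁, hg, hAg, hBg, hco⟩ : ∃ g A₁ B₁ : ℂ[X], g ≠ 0 ∧ A = g * A₁ ∧ B = g * B₁ ∧
      IsCoprime A₁ B₁ := by
    have hgcd : EuclideanDomain.gcd A B ≠ 0 := fun h => hA (EuclideanDomain.gcd_eq_zero_iff.1 h).1
    obtain ⟨A₁, hA₁⟩ := EuclideanDomain.gcd_dvd_left A B
    obtain ⟨B₁, hB₁⟩ := EuclideanDomain.gcd_dvd_right A B
    refine ⟨_, A₁, B₁, hgcd, hA₁, hB₁, ?_⟩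
    refine ⟨EuclideanDomain.gcdA A B, EuclideanDomain.gcdB A B, mul_left_cancel₀ hgcd ?_⟩
    calc _ = (EuclideanDomain.gcd A B * A₁) * EuclideanDomain.gcdA A B +
          (EuclideanDomain.gcd A B * B₁) * EuclideanDomain.gcdB A B := by ring
      _ = _ := by rw [← hA₁, ← hB₁, ← EuclideanDomain.gcd_eq_gcd_ab, mul_one]
  have hA₁ : A₁ ≠ 0 := by rintro rfl; exact hA (by rw [hAg, mul_zero])
  have hC0 : C ≠ 0 := by rintro rfl; simp at hC
  have hdA : A.natDegree = g.natDegree + A₁.natDegree := by rw [hAg, natDegree_mul hg hA₁]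
  have hdB : 2 * B₁.natDegree < 2 * A₁.natDegree + C.natDegree := by
    rcases eq_or_ne B₁ 0 with rfl | h
    · simp; omega
    · rw [hBg, natDegree_mul hg h] at hB; omega
  set R := 3 * B₁ ^ 2 + A₁ ^ 2 * C with hR
  have hdAC : (A₁ ^ 2 * C).natDegree = 2 * A₁.natDegree + C.natDegree := by
    rw [natDegree_mul (pow_ne_zero _ hA₁) hC0, natDegree_pow]
  have hdR : R.natDegree = 2 * A₁.natDegree + C.natDegree := by
    rw [← hdAC, hR]
    refine natDegree_add_eq_right_of_natDegree_lt ?_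
    rw [hdAC]
    refine lt_of_le_of_lt ?_ hdB
    rw [← natDegree_pow]
    exact natDegree_C_mul_le 3 (B₁ ^ 2)
  have hR0 : R ≠ 0 := by intro h; rw [h, natDegree_zero] at hdR; omega
  set Q := g * R with hQ
  have hQ0 : Q ≠ 0 := mul_ne_zero hg hR0
  have hdQ : A₁.natDegree + 2 ≤ Q.natDegree := by
    rw [hQ, natDegree_mul hg hR0]; omega
  have hS' : ∀ x y, (x, y) ∈ S ↔ 3 * x ^ 2 + C.eval y = 0 ∧
      g.eval y * (A₁.eval y * x + B₁.eval y) = 0 := by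
    intro x y
    rw [hS, hAg, hBg]
    simp only [eval_mul]
    rw [mul_add, mul_assoc]
  have hJ' : ∀ x y, J (x, y) = 6 * x * (g.derivative.eval y * (A₁.eval y * x + B₁.eval y) +
      g.eval y * (A₁.derivative.eval y * x + B₁.derivative.eval y)) -
      C.derivative.eval y * (g.eval y * A₁.eval y) := by
    intro x y
    rw [hJ, hAg, hBg]
    simp only [eval_mul, derivative_mul, eval_add]
    ring
  have hQ' : ∀ y, Q.derivative.eval y = g.derivative.eval y * (3 * B₁.eval y ^ 2 +
      A₁.eval y ^ 2 * C.eval y) + g.eval y * (6 * B₁.eval y * B₁.derivative.eval y +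
      2 * A₁.eval y * A₁.derivative.eval y * C.eval y +
      A₁.eval y ^ 2 * C.derivative.eval y) := by
    intro y
    simp only [hQ, hR, derivative_mul, derivative_add, derivative_pow, derivative_ofNat, eval_add,
      eval_mul, eval_pow, eval_ofNat, eval_C, eval_zero, Nat.cast_ofNat]
    ring
  have hcop : ∀ y, A₁.eval y = 0 → B₁.eval y ≠ 0 := by
    intro y ha hb
    obtain ⟨u, v, huv⟩ := hco
    simpa [ha, hb] using congrArg (eval y) huv
  have hroot : ∀ q ∈ S, q.2 ∈ Q.roots.toFinset := by
    rintro ⟨x, y⟩ hq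
    obtain ⟨h₁, h₂⟩ := (hS' x y).1 hq
    rw [Multiset.mem_toFinset, mem_roots hQ0]
    simp only [IsRoot, hQ, hR, eval_mul, eval_add, eval_pow, eval_ofNat]
    linear_combination (g.eval y * A₁.eval y ^ 2) * h₁ +
      3 * (B₁.eval y - A₁.eval y * x) * h₂
  have hfiber : ∀ y ∈ Q.roots.toFinset, Q.derivative.eval y ≠ 0 ∧ ∃ T : Finset ℂ,
      (∀ x, x ∈ T ↔ (x, y) ∈ S) ∧
      ∑ x ∈ T, 1 / J (x, y) = -(A₁.eval y / Q.derivative.eval y) := by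
    intro y hy
    rw [Multiset.mem_toFinset, mem_roots hQ0] at hy
    simp only [IsRoot, hQ, hR, eval_mul, eval_add, eval_pow, eval_ofNat] at hy
    by_cases hgy : g.eval y = 0
    · obtain ⟨w, hw⟩ := IsAlgClosed.exists_pow_nat_eq (-(C.eval y) / 3) (n := 2) (by norm_num)
      have hw' : C.eval y = -(3 * w ^ 2) := by rw [hw]; ring
      have hmem : ∀ x, (x, y) ∈ S ↔ x = w ∨ x = -w := by
        intro x
        rw [hS', hgy, zero_mul, ← sq_eq_sq_iff_eq_or_eq_neg, hw']
        constructor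
        · rintro ⟨h, -⟩
          linear_combination h / 3
        · intro h
          exact ⟨by linear_combination 3 * h, rfl⟩
      have h₁ := hJ0 _ ((hmem w).2 (.inl rfl))
      have h₂ := hJ0 _ ((hmem (-w)).2 (.inr rfl))
      have e₁ : J (w, y) = 6 * w * g.derivative.eval y * (B₁.eval y + A₁.eval y * w) := by
        rw [hJ', hgy]; ring
      have e₂ : J (-w, y) = -(6 * w * g.derivative.eval y * (B₁.eval y - A₁.eval y * w)) := by
        rw [hJ', hgy]; ring
      have e₃ : Q.derivative.eval y = 3 * g.derivative.eval y *
          (B₁.eval y + A₁.eval y * w) * (B₁.eval y - A₁.eval y * w) := by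
        rw [hQ', hgy, hw']; ring
      rw [e₁] at h₁
      rw [e₂, neg_ne_zero] at h₂
      have hp := right_ne_zero_of_mul h₁
      have hm := right_ne_zero_of_mul h₂
      have hg' := right_ne_zero_of_mul (left_ne_zero_of_mul h₁)
      have hw0 := right_ne_zero_of_mul (left_ne_zero_of_mul (left_ne_zero_of_mul h₁))
      refine ⟨by rw [e₃]; exact mul_ne_zero (mul_ne_zero (mul_ne_zero three_ne_zero hg') hp) hm,
        {w, -w}, fun x => by rw [hmem]; simp, ?_⟩
      rw [Finset.sum_pair (fun h => hw0 (self_eq_neg.1 h)), e₁, e₂, e₃]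
      have hpm : (B₁.eval y - A₁.eval y * w) - (B₁.eval y + A₁.eval y * w) =
          -(2 * A₁.eval y * w) := by ring
      generalize B₁.eval y + A₁.eval y * w = p at hp hpm ⊢
      generalize B₁.eval y - A₁.eval y * w = m at hm hpm ⊢
      field_simp
      linear_combination 3 * hpm
    · have hRy := (mul_eq_zero.1 hy).resolve_left hgy
      have ha : A₁.eval y ≠ 0 := by
        intro ha
        refine hcop y ha ?_
        simpa [ha] using hRy
      obtain ⟨x, hx⟩ : ∃ x, B₁.eval y = -(A₁.eval y * x) :=
        ⟨-(B₁.eval y) / A₁.eval y, by field_simp⟩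
      have hCx : C.eval y = -(3 * x ^ 2) := by
        refine mul_left_cancel₀ (pow_ne_zero 2 ha) ?_
        rw [hx] at hRy
        linear_combination hRy
      have hmem : ∀ z, (z, y) ∈ S ↔ z = x := by
        intro z
        rw [hS', hx, hCx]
        constructor
        · rintro ⟨-, h⟩
          have := (mul_eq_zero.1 h).resolve_left hgy
          refine mul_left_cancel₀ ha ?_
          linear_combination this
        · rintro rfl
          constructor <;> ring
      have hJx := hJ0 _ ((hmem x).2 rfl)
      have e : Q.derivative.eval y = -(A₁.eval y * J (x, y)) := by
        rw [hQ', hJ', hx, hCx]; ring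
      refine ⟨by rw [e]; exact neg_ne_zero.2 (mul_ne_zero ha hJx), {x},
        fun z => by rw [hmem]; simp, ?_⟩
      rw [Finset.sum_singleton, e]
      field_simp
  choose! hder T hT hsum using hfiber
  let F : Finset (ℂ × ℂ) := Q.roots.toFinset.biUnion fun y => (T y).image fun x => (x, y)
  have hF : S = F := by
    ext ⟨x, y⟩
    simp only [F, Finset.mem_coe, Finset.mem_biUnion, Finset.mem_image, Prod.mk.injEq]
    constructor
    · intro h
      exact ⟨y, hroot _ h, x, (hT y (hroot _ h) x).2 h, rfl, rfl⟩
    · rintro ⟨y, hy, x, hx, rfl, rfl⟩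
      exact (hT y hy x).1 hx
  refine ⟨hF ▸ F.finite_toSet, ?_⟩
  rw [hF, finsum_mem_coe_finset, Finset.sum_biUnion]
  · calc _ = ∑ y ∈ Q.roots.toFinset, -(A₁.eval y / Q.derivative.eval y) := by
          refine Finset.sum_congr rfl fun y hy => ?_
          rw [Finset.sum_image (fun a _ b _ h => congrArg Prod.fst h), hsum y hy]
      _ = 0 := by
          rw [Finset.sum_neg_distrib, sum_eval_div_eval_derivative_roots hdQ
            (fun z hz => hder z (Multiset.mem_toFinset.2 hz)), neg_zero]
  · intro y _ z _ hyz
    simp only [Function.onFun, Finset.disjoint_left, Finset.mem_image]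
    rintro _ ⟨a, _, rfl⟩ ⟨b, _, h⟩
    exact hyz (congrArg Prod.snd h).symm

open Polynomial in
/-- Complexified E₇ magnification relation. -/
theorem E7_complex_magnification_relation (c₁ c₂ c₃ c₄ : ℂ) (s : ℂ × ℂ)
    (f : ℂ × ℂ → ℂ × ℂ)
    (hf : ∀ x y : ℂ, f (x, y) =
      (3 * x ^ 2 + y ^ 3 + c₁ * y,
       3 * x * y ^ 2 + 4 * c₄ * y ^ 3 + 3 * c₃ * y ^ 2 + 2 * c₂ * y + c₁ * x))
    (J : ℂ × ℂ → ℂ)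
    (hJ : ∀ x y : ℂ, J (x, y) =
      deriv (fun t => (f (t, y)).1) x * deriv (fun t => (f (x, t)).2) y -
      deriv (fun t => (f (x, t)).1) y * deriv (fun t => (f (t, y)).2) x)
    (hnc : ∀ q ∈ f ⁻¹' {s}, J q ≠ 0) :
    (f ⁻¹' {s}).Finite ∧ ∑ᶠ q ∈ f ⁻¹' {s}, 1 / J q = 0 := by
  let A : ℂ[X] := C 3 * X ^ 2 + C c₁
  let B : ℂ[X] := C (4 * c₄) * X ^ 3 + C (3 * c₃) * X ^ 2 + C (2 * c₂) * X + C (-s.2)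
  let D : ℂ[X] := X ^ 3 + C c₁ * X + C (-s.1)
  have hdA : A.natDegree = 2 := by simp only [A]; compute_degree!
  have hdB : B.natDegree ≤ 3 := by simp only [B]; compute_degree
  have hdD : D.natDegree = 3 := by simp only [D]; compute_degree!
  refine finite_and_finsum_inv_jacobian_eq_zero (A := A) (B := B) (C := D)
    (by intro h; simp [h] at hdA) (by omega) (by omega) ?_ ?_ hnc
  · rintro ⟨x, y⟩
    rw [Set.mem_preimage, Set.mem_singleton_iff, hf, Prod.ext_iff]
    simp only [A, B, D, eval_add, eval_mul, eval_C, eval_pow, eval_X]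
    constructor
    · rintro ⟨h₁, h₂⟩
      exact ⟨by linear_combination h₁, by linear_combination h₂⟩
    · rintro ⟨h₁, h₂⟩
      exact ⟨by linear_combination h₁, by linear_combination h₂⟩
  · intro x y
    have d₁ : deriv (fun t => (f (t, y)).1) x = 6 * x := by
      have h : (fun t => (f (t, y)).1) =
          fun t => (C 3 * X ^ 2 + C (y ^ 3 + c₁ * y) : ℂ[X]).eval t := by
        funext t; simp [hf]; ring
      rw [h, Polynomial.deriv]
      simp only [derivative_add, derivative_C_mul_X_pow, derivative_C, eval_add, eval_mul, eval_C,
        eval_pow, eval_X, eval_zero]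
      norm_num
    have d₂ : deriv (fun t => (f (x, t)).2) y =
        A.derivative.eval y * x + B.derivative.eval y := by
      have h : (fun t => (f (x, t)).2) = fun t => (A * C x + B + C s.2).eval t := by
        funext t; simp [hf, A, B]; ring
      rw [h, Polynomial.deriv]
      simp
    have d₃ : deriv (fun t => (f (x, t)).1) y = D.derivative.eval y := by
      have h : (fun t => (f (x, t)).1) = fun t => (D + C (3 * x ^ 2 + s.1)).eval t := by
        funext t; simp [hf, D]; ring
      rw [h, Polynomial.deriv, derivative_add, derivative_C, add_zero]
    have d₄ : deriv (fun t => (f (t, y)).2) x = A.eval y := by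
      have h : (fun t => (f (t, y)).2) =
          fun t => (C (A.eval y) * X + C (B.eval y + s.2)).eval t := by
        funext t; simp [hf, A, B]; ring
      rw [h, Polynomial.deriv]
      simp
    rw [hJ, d₁, d₂, d₃, d₄]
end

section
/- Let c₁, c₂, c₃, c₄, c₅ ∈ ℂ. Define the complexified E₈ map f : ℂ² → ℂ² by f(x,y) = (3x² + c₅y³ + c₄y² + c₁y, 5y⁴ + 3c₅xy² + 2c₄xy + 3c₃y² + 2c₂y + c₁x). If s ∈ ℂ² is non-caustic, i.e., J_f(x,y) ≠ 0 for every (x,y) ∈ f⁻¹(s), then the fiber f⁻¹(s) is a finite set and Σ_{(x,y) ∈ f⁻¹(s)} 1/J_f(x,y) = 0. -/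
open Polynomial

/-- If all roots of a split polynomial `D` are simple and `deg p + 2 ≤ deg D`, then the sum of the
residues of `p / D` vanishes. -/
theorem sum_roots_eval_div_eval_derivative_eq_zero {K : Type*} [Field K] [DecidableEq K]
    {p D : K[X]} (hD : D.Splits) (hdeg : p.natDegree + 2 ≤ D.natDegree)
    (hsimple : ∀ y ∈ D.roots, D.derivative.eval y ≠ 0) :
    ∑ y ∈ D.roots.toFinset, p.eval y / D.derivative.eval y = 0 := by
  have hD0 : D ≠ 0 := by
    rintro rfl
    simp at hdeg
  have hnodup : D.roots.Nodup := by
    rw [Multiset.nodup_iff_count_le_one]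
    intro y
    rw [count_roots]
    by_contra! h
    obtain ⟨h₁, h₂⟩ := (one_lt_rootMultiplicity_iff_isRoot hD0).1 h
    exact hsimple y ((mem_roots hD0).2 h₁) h₂
  have hcard : D.roots.toFinset.card = D.natDegree := by
    rw [Multiset.toFinset_card_of_nodup hnodup, hD.natDegree_eq_card_roots]
  have hnodal : D = C D.leadingCoeff * Lagrange.nodal D.roots.toFinset id := by
    conv_lhs => rw [hD.eq_prod_roots]
    rw [Lagrange.nodal_eq, Finset.prod, Multiset.toFinset_val, hnodup.dedup]
    rfl
  have hsum := Lagrange.coeff_eq_sum (s := D.roots.toFinset) (v := id) (P := p)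
    Function.injective_id.injOn
    (by rw [hcard]; exact degree_le_natDegree.trans_lt (by norm_cast; omega))
  rw [coeff_eq_zero_of_natDegree_lt (by omega)] at hsum
  have hterm : ∀ y ∈ D.roots.toFinset, p.eval y / D.derivative.eval y =
      D.leadingCoeff⁻¹ * (p.eval y / ∏ j ∈ D.roots.toFinset.erase y, (y - j)) := by
    intro y hy
    have := Lagrange.eval_nodal_derivative_eval_node_eq (v := id) hy
    rw [Lagrange.eval_nodal] at this
    have hder : D.derivative.eval y =
        D.leadingCoeff * ∏ j ∈ D.roots.toFinset.erase y, (y - j) := by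
      conv_lhs => rw [hnodal]
      rw [derivative_C_mul, eval_C_mul]
      exact congrArg _ this
    rw [hder, mul_comm, div_mul_eq_div_div, div_eq_inv_mul (p.eval y / _)]
  rw [Finset.sum_congr rfl hterm, ← Finset.mul_sum]
  simp only [id] at hsum
  rw [← hsum, mul_zero]

/-- The Euler-Jacobi vanishing formula for a system `3x² + N(y) = x L(y) + M(y) = 0` all of whose
solutions are nondegenerate. -/
theorem euler_jacobi_quadratic_linear {L M N : ℂ[X]} {J : ℂ × ℂ → ℂ} {S : Set (ℂ × ℂ)}
    (hdeg : L.natDegree + 2 ≤ (3 * M ^ 2 + N * L ^ 2).natDegree)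
    (hS : ∀ x y, (x, y) ∈ S ↔ 3 * x ^ 2 + N.eval y = 0 ∧ x * L.eval y + M.eval y = 0)
    (hJ : ∀ x y, J (x, y) = 6 * x * (x * L.derivative.eval y + M.derivative.eval y) -
      N.derivative.eval y * L.eval y)
    (hJ0 : ∀ q ∈ S, J q ≠ 0) :
    S.Finite ∧ ∑ᶠ q ∈ S, 1 / J q = 0 := by
  classical
  obtain ⟨l, m, hlm, hLg, hMg⟩ : ∃ l m : ℂ[X], IsCoprime l m ∧
      L = EuclideanDomain.gcd L M * l ∧ M = EuclideanDomain.gcd L M * m := by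
    have hg : EuclideanDomain.gcd L M ≠ 0 := by
      intro h
      obtain ⟨rfl, rfl⟩ := EuclideanDomain.gcd_eq_zero_iff.1 h
      simp at hdeg
    obtain ⟨l, hl⟩ := EuclideanDomain.gcd_dvd_left L M
    obtain ⟨m, hm⟩ := EuclideanDomain.gcd_dvd_right L M
    refine ⟨l, m, ?_, hl, hm⟩
    refine ⟨EuclideanDomain.gcdA L M, EuclideanDomain.gcdB L M, mul_left_cancel₀ hg ?_⟩
    have := EuclideanDomain.gcd_eq_gcd_ab L M
    linear_combination -this - EuclideanDomain.gcdA L M * hl - EuclideanDomain.gcdB L M * hm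
  generalize EuclideanDomain.gcd L M = g at hLg hMg
  subst hLg hMg
  set D : ℂ[X] := g * (3 * m ^ 2 + N * l ^ 2) with hD
  have hR : 3 * (g * m) ^ 2 + N * (g * l) ^ 2 = D * g := by rw [hD]; ring
  rw [hR] at hdeg
  have hDg : D * g ≠ 0 := by
    intro h
    simp [h] at hdeg
  have hD0 : D ≠ 0 := left_ne_zero_of_mul hDg
  have hg0 : g ≠ 0 := right_ne_zero_of_mul hDg
  have hDeval : ∀ y, D.eval y = g.eval y * (3 * m.eval y ^ 2 + N.eval y * l.eval y ^ 2) := by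
    intro y
    simp [hD]
  have hDder : ∀ y, D.derivative.eval y =
      g.derivative.eval y * (3 * m.eval y ^ 2 + N.eval y * l.eval y ^ 2) +
      g.eval y * (6 * m.eval y * m.derivative.eval y + N.derivative.eval y * l.eval y ^ 2 +
        2 * N.eval y * l.eval y * l.derivative.eval y) := by
    intro y
    simp [hD, derivative_mul, derivative_pow, -mul_eq_mul_left_iff]
    ring
  simp only [derivative_mul, eval_add, eval_mul] at hS hJ
  have hroot : ∀ q ∈ S, q.2 ∈ D.roots.toFinset := by
    rintro ⟨x, y⟩ hq
    obtain ⟨h₁, h₂⟩ := (hS x y).1 hq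
    rw [Multiset.mem_toFinset, mem_roots hD0, IsRoot, hDeval]
    linear_combination g.eval y * l.eval y ^ 2 * h₁ +
      3 * (m.eval y - x * l.eval y) * h₂
  have hsqrt : ∀ y, ∃ x : ℂ, 3 * x ^ 2 + N.eval y = 0 := by
    intro y
    obtain ⟨x, hx⟩ := IsAlgClosed.exists_pow_nat_eq (-N.eval y / 3) (n := 2) (by norm_num)
    exact ⟨x, by rw [hx]; ring⟩
  have hpm : ∀ {y x z : ℂ}, 3 * x ^ 2 + N.eval y = 0 → 3 * z ^ 2 + N.eval y = 0 →
      z = x ∨ z = -x := by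
    intro y x z hx hz
    exact sq_eq_sq_iff_eq_or_eq_neg.1 (by linear_combination (hz - hx) / 3)
  have hfin : S.Finite := by
    refine Set.Finite.subset (D.roots.toFinset.finite_toSet.biUnion
      (t := fun y => {((hsqrt y).choose, y), (-(hsqrt y).choose, y)})
      fun y _ => Set.toFinite _) ?_
    rintro ⟨x, y⟩ hq
    refine Set.mem_biUnion (hroot _ hq) ?_
    rcases hpm (hsqrt y).choose_spec ((hS x y).1 hq).1 with h | h <;> simp [← h]
  refine ⟨hfin, ?_⟩
  have hfiber : ∀ y ∈ D.roots.toFinset, D.derivative.eval y ≠ 0 ∧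
      ∑ q ∈ hfin.toFinset with q.2 = y, 1 / J q = -(l.eval y / D.derivative.eval y) := by
    intro y hy
    rw [Multiset.mem_toFinset, mem_roots hD0, IsRoot, hDeval] at hy
    by_cases hgy : g.eval y = 0
    · obtain ⟨x, hx⟩ := hsqrt y
      have hx' : 3 * (-x) ^ 2 + N.eval y = 0 := by rw [neg_sq, hx]
      have hJ₁ := hJ0 _ ((hS x y).2 ⟨hx, by simp [hgy]⟩)
      have hJ₂ := hJ0 _ ((hS (-x) y).2 ⟨hx', by simp [hgy]⟩)
      have hset : {q ∈ hfin.toFinset | q.2 = y} = {(x, y), (-x, y)} := by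
        ext ⟨a, b⟩
        simp only [Finset.mem_filter, Set.Finite.mem_toFinset, Finset.mem_insert,
          Finset.mem_singleton, Prod.mk.injEq]
        constructor
        · rintro ⟨h, rfl⟩
          simpa using hpm hx ((hS a b).1 h).1
        · rintro (⟨rfl, rfl⟩ | ⟨rfl, rfl⟩)
          · exact ⟨(hS _ _).2 ⟨hx, by simp [hgy]⟩, rfl⟩
          · exact ⟨(hS _ _).2 ⟨hx', by simp [hgy]⟩, rfl⟩
      have hJx : J (x, y) = 6 * x * g.derivative.eval y * (m.eval y + x * l.eval y) := by
        rw [hJ, hgy]; ring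
      have hJx' : J (-x, y) = -6 * x * g.derivative.eval y * (m.eval y - x * l.eval y) := by
        rw [hJ, hgy]; ring
      have hder : D.derivative.eval y = 3 * g.derivative.eval y *
          ((m.eval y + x * l.eval y) * (m.eval y - x * l.eval y)) := by
        rw [hDder, hgy]
        linear_combination g.derivative.eval y * l.eval y ^ 2 * hx
      rw [hJx] at hJ₁
      rw [hJx'] at hJ₂
      simp only [mul_ne_zero_iff] at hJ₁ hJ₂
      obtain ⟨⟨⟨-, hx0⟩, hg'⟩, hp⟩ := hJ₁
      have hm := hJ₂.2
      have hne : (x, y) ≠ (-x, y) := by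
        intro h
        exact hx0 (self_eq_neg.1 (Prod.mk.inj h).1)
      rw [hset, Finset.sum_pair hne, hJx, hJx', hder]
      refine ⟨by simp [hg', hp, hm], ?_⟩
      field_simp
      ring
    · have hq : 3 * m.eval y ^ 2 + N.eval y * l.eval y ^ 2 = 0 :=
        (mul_eq_zero.1 hy).resolve_left hgy
      have hl : l.eval y ≠ 0 := by
        intro hl
        have hm : m.eval y = 0 := by simpa [hl] using hq
        obtain ⟨a, b, hab⟩ := hlm
        simpa [hl, hm] using congrArg (eval y) hab
      obtain ⟨x, hxm⟩ : ∃ x, m.eval y = -(x * l.eval y) :=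
        ⟨-m.eval y / l.eval y, by field_simp⟩
      have hx : 3 * x ^ 2 + N.eval y = 0 := by
        rw [hxm] at hq
        refine mul_left_cancel₀ (pow_ne_zero 2 hl) ?_
        linear_combination hq
      have hmem : (x, y) ∈ S := (hS x y).2 ⟨hx, by rw [hxm]; ring⟩
      have hset : {q ∈ hfin.toFinset | q.2 = y} = {(x, y)} := by
        ext ⟨a, b⟩
        simp only [Finset.mem_filter, Set.Finite.mem_toFinset, Finset.mem_singleton,
          Prod.mk.injEq]
        constructor
        · rintro ⟨h, rfl⟩
          refine ⟨mul_left_cancel₀ (mul_ne_zero hgy hl) ?_, rfl⟩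
          linear_combination ((hS a b).1 h).2 - g.eval b * hxm
        · rintro ⟨rfl, rfl⟩
          exact ⟨hmem, rfl⟩
      have hder : D.derivative.eval y = -(l.eval y * J (x, y)) := by
        rw [hDder, hJ, hxm]
        linear_combination (g.derivative.eval y * l.eval y ^ 2 +
          2 * g.eval y * l.eval y * l.derivative.eval y) * hx
      have hJxy := hJ0 _ hmem
      rw [hset, Finset.sum_singleton, hder]
      refine ⟨neg_ne_zero.2 (mul_ne_zero hl hJxy), ?_⟩
      field_simp
  rw [finsum_mem_eq_finite_toFinset_sum _ hfin, ← Finset.sum_fiberwise_of_maps_to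
    (g := Prod.snd) (fun q hq => hroot q (hfin.mem_toFinset.1 hq)),
    Finset.sum_congr rfl fun y hy => (hfiber y hy).2, Finset.sum_neg_distrib, neg_eq_zero]
  rcases eq_or_ne l 0 with hl | hl
  · simp [hl]
  · rw [natDegree_mul hg0 hl, natDegree_mul hD0 hg0] at hdeg
    exact sum_roots_eval_div_eval_derivative_eq_zero (IsAlgClosed.splits D) (by omega)
      fun y hy => (hfiber y (Multiset.mem_toFinset.2 hy)).1


/-- Complexified E₈ magnification relation. -/
theorem E8_complex_magnification_relation (c₁ c₂ c₃ c₄ c₅ : ℂ) (s : ℂ × ℂ)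
    (f : ℂ × ℂ → ℂ × ℂ)
    (hf : ∀ x y : ℂ, f (x, y) =
      (3 * x ^ 2 + c₅ * y ^ 3 + c₄ * y ^ 2 + c₁ * y,
       5 * y ^ 4 + 3 * c₅ * x * y ^ 2 + 2 * c₄ * x * y + 3 * c₃ * y ^ 2 + 2 * c₂ * y + c₁ * x))
    (J : ℂ × ℂ → ℂ)
    (hJ : ∀ x y : ℂ, J (x, y) =
      deriv (fun t => (f (t, y)).1) x * deriv (fun t => (f (x, t)).2) y -
      deriv (fun t => (f (x, t)).1) y * deriv (fun t => (f (t, y)).2) x)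
    (hnc : ∀ q ∈ f ⁻¹' {s}, J q ≠ 0) :
    (f ⁻¹' {s}).Finite ∧ ∑ᶠ q ∈ f ⁻¹' {s}, 1 / J q = 0 := by
  have hJ' : ∀ x y : ℂ, J (x, y) =
      6 * x * (20 * y ^ 3 + 6 * c₅ * x * y + 2 * c₄ * x + 6 * c₃ * y + 2 * c₂) -
      (3 * c₅ * y ^ 2 + 2 * c₄ * y + c₁) * (3 * c₅ * y ^ 2 + 2 * c₄ * y + c₁) := by
    intro x y
    have h₁ : deriv (fun t => (f (t, y)).1) x = 6 * x := by
      simp only [hf]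
      refine (((((hasDerivAt_id' x).pow 2).const_mul 3).add_const _).add_const _
        |>.add_const _).deriv.trans ?_
      norm_num
      ring
    have h₂ : deriv (fun t => (f (x, t)).2) y =
        20 * y ^ 3 + 6 * c₅ * x * y + 2 * c₄ * x + 6 * c₃ * y + 2 * c₂ := by
      simp only [hf]
      have h := hasDerivAt_id' y
      refine ((((((h.pow 4).const_mul 5).add ((h.pow 2).const_mul (3 * c₅ * x))).add
        (h.const_mul (2 * c₄ * x))).add ((h.pow 2).const_mul (3 * c₃))).add
        (h.const_mul (2 * c₂)) |>.add_const (c₁ * x)).deriv.trans ?_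
      norm_num
      ring
    have h₃ : deriv (fun t => (f (x, t)).1) y = 3 * c₅ * y ^ 2 + 2 * c₄ * y + c₁ := by
      simp only [hf]
      have h := hasDerivAt_id' y
      refine ((((h.pow 3).const_mul c₅).const_add (3 * x ^ 2)).add ((h.pow 2).const_mul c₄)
        |>.add (h.const_mul c₁)).deriv.trans ?_
      norm_num
      ring
    have h₄ : deriv (fun t => (f (t, y)).2) x = 3 * c₅ * y ^ 2 + 2 * c₄ * y + c₁ := by
      simp only [hf]
      have h := hasDerivAt_id' x
      refine (((((h.const_mul (3 * c₅)).mul_const (y ^ 2)).const_add (5 * y ^ 4)).add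
        ((h.const_mul (2 * c₄)).mul_const y)).add_const _ |>.add_const _
        |>.add (h.const_mul c₁)).deriv.trans ?_
      ring
    rw [hJ, h₁, h₂, h₃, h₄]
  obtain ⟨s₁, s₂⟩ := s
  let L : ℂ[X] := C (3 * c₅) * X ^ 2 + C (2 * c₄) * X + C c₁
  let M : ℂ[X] := C 5 * X ^ 4 + C (3 * c₃) * X ^ 2 + C (2 * c₂) * X - C s₂
  let N : ℂ[X] := C c₅ * X ^ 3 + C c₄ * X ^ 2 + C c₁ * X - C s₁
  have hL : L.natDegree ≤ 2 := by
    simp only [L]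
    compute_degree
  have hM : M.natDegree = 4 := by
    simp only [M]
    compute_degree!
  have hN : N.natDegree ≤ 3 := by
    simp only [N]
    compute_degree
  have hM2 : (3 * M ^ 2).natDegree = 8 := by
    rw [← C_ofNat, natDegree_C_mul (by norm_num), natDegree_pow, hM]
  have hNL : (N * L ^ 2).natDegree ≤ 7 :=
    natDegree_mul_le_of_le hN (natDegree_pow_le_of_le 2 hL)
  have hR : (3 * M ^ 2 + N * L ^ 2).natDegree = 8 := by
    rw [natDegree_add_eq_left_of_natDegree_lt (by omega), hM2]
  refine euler_jacobi_quadratic_linear (L := L) (M := M) (N := N) (by omega) ?_ ?_ hnc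
  · intro x y
    simp only [Set.mem_preimage, Set.mem_singleton_iff, hf, Prod.mk.injEq, L, M, N, eval_add,
      eval_sub, eval_mul, eval_pow, eval_C, eval_X]
    constructor
    · rintro ⟨h₁, h₂⟩
      exact ⟨by linear_combination h₁, by linear_combination h₂⟩
    · rintro ⟨h₁, h₂⟩
      exact ⟨by linear_combination h₁, by linear_combination h₂⟩
  · intro x y
    rw [hJ']
    simp [L, M, N]
    ring
end

section
/- Let c ∈ ℂ. Define the complexified elliptic umbilic map η : ℂ² → ℂ² by η(x,y) = (x² − y², −2xy + 4cy). If s ∈ ℂ² is non-caustic, i.e., J_η(x,y) ≠ 0 for every (x,y) ∈ η⁻¹(s), then the fiber η⁻¹(s) is a finite set and Σ_{(x,y) ∈ η⁻¹(s)} 1/J_η(x,y) = 0. -/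
open Polynomial in
/-- Euler–Jacobi vanishing in one variable: for a monic split polynomial with simple roots, the
residues of `Q / P` sum to zero when `deg Q ≤ deg P - 2`. -/
theorem Polynomial.sum_roots_eval_div_derivative_eq_zero {F : Type*} [Field F] [DecidableEq F]
    {P Q : F[X]} (hP : P.Monic) (hs : P.Splits)
    (hsimple : ∀ a, P.IsRoot a → (derivative P).eval a ≠ 0)
    (hQ : Q.natDegree + 1 < P.natDegree) :
    ∑ a ∈ P.roots.toFinset, Q.eval a / (derivative P).eval a = 0 := by
  have hnodup : P.roots.Nodup := by
    rw [Multiset.nodup_iff_count_le_one]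
    intro a
    rw [count_roots]
    by_contra! h
    obtain ⟨h₀, h₁⟩ := (one_lt_rootMultiplicity_iff_isRoot hP.ne_zero).1 h
    exact hsimple a h₀ h₁
  have hcard : P.roots.toFinset.card = P.natDegree := by
    rw [Multiset.toFinset_card_of_nodup hnodup, hs.natDegree_eq_card_roots]
  have hnodal : P = Lagrange.nodal P.roots.toFinset id := by
    conv_lhs => rw [hs.eq_prod_roots_of_monic hP]
    rw [Lagrange.nodal, Finset.prod, Multiset.toFinset_val, hnodup.dedup]
    simp
  have hsum := Lagrange.coeff_eq_sum (s := P.roots.toFinset) (v := id)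
    (Function.injective_id.injOn) (P := Q)
    (degree_le_natDegree.trans_lt (by rw [hcard]; exact_mod_cast (by lia)))
  rw [coeff_eq_zero_of_natDegree_lt (by rw [hcard]; lia)] at hsum
  rw [hsum]
  refine Finset.sum_congr rfl fun a ha => ?_
  have h := Lagrange.eval_nodal_derivative_eval_node_eq (v := id) ha
  rw [← hnodal, Lagrange.eval_nodal] at h
  simp only [id] at h ⊢
  rw [h]

/-- The fiber lying over a target point on the axis `b = 0`. -/
theorem elliptic_umbilic_fiber_axis {c a r w : ℂ} (hr : r ^ 2 = a) (hw : w ^ 2 = 4 * c ^ 2 - a) :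
    {q : ℂ × ℂ | q.1 ^ 2 - q.2 ^ 2 = a ∧ -2 * q.1 * q.2 + 4 * c * q.2 = 0} =
      (({(r, 0), (-r, 0), (2 * c, w), (2 * c, -w)} : Finset (ℂ × ℂ)) : Set (ℂ × ℂ)) := by
  ext ⟨x, y⟩
  simp only [Set.mem_ofPred_eq, Finset.coe_insert, Finset.coe_singleton, Set.mem_insert_iff,
    Set.mem_singleton_iff, Prod.mk.injEq]
  constructor
  · rintro ⟨h₁, h₂⟩
    have h₃ : y * (x - 2 * c) = 0 := by linear_combination -h₂ / 2
    rcases mul_eq_zero.1 h₃ with hy | hx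
    · subst hy
      have : x = r ∨ x = -r := sq_eq_sq_iff_eq_or_eq_neg.1 (by linear_combination h₁ - hr)
      tauto
    · have hx' : x = 2 * c := by linear_combination hx
      subst hx'
      have : y = w ∨ y = -w := sq_eq_sq_iff_eq_or_eq_neg.1 (by linear_combination -h₁ - hw)
      tauto
  · rintro (⟨rfl, rfl⟩ | ⟨rfl, rfl⟩ | ⟨rfl, rfl⟩ | ⟨rfl, rfl⟩) <;> constructor <;>
      first
      | linear_combination hr
      | linear_combination -hw
      | ring

/-- Off the axis `b = 0`, the fiber is a graph over the roots of the eliminant in `x`. -/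
theorem elliptic_umbilic_fiber_eq_image {c a b : ℂ} (hb : b ≠ 0) :
    {q : ℂ × ℂ | q.1 ^ 2 - q.2 ^ 2 = a ∧ -2 * q.1 * q.2 + 4 * c * q.2 = b} =
      (fun x => (x, b / (4 * c - 2 * x))) ''
        {x : ℂ | (x ^ 2 - a) * (x - 2 * c) ^ 2 - b ^ 2 / 4 = 0} := by
  ext ⟨x, y⟩
  simp only [Set.mem_ofPred_eq, Set.mem_image, Prod.mk.injEq]
  constructor
  · rintro ⟨h₁, h₂⟩
    have hx : 4 * c - 2 * x ≠ 0 := fun h => hb (by linear_combination y * h - h₂)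
    refine ⟨x, ?_, rfl, ?_⟩
    · rw [← h₁, ← h₂]
      ring
    · rw [div_eq_iff hx]
      linear_combination -h₂
  · rintro ⟨x, h, rfl, rfl⟩
    have hx : 4 * c - 2 * x ≠ 0 := by
      intro h'
      have : b ^ 2 = 0 := by
        linear_combination -4 * h - 2 * (x ^ 2 - a) * (x - 2 * c) * h'
      exact hb (by simpa using this)
    have hy : b / (4 * c - 2 * x) * (4 * c - 2 * x) = b := div_mul_cancel₀ b hx
    constructor
    · refine mul_left_cancel₀ (pow_ne_zero 2 hx) ?_
      linear_combination 4 * h - (b / (4 * c - 2 * x) * (4 * c - 2 * x) + b) * hy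
    · linear_combination hy

/-- Complexified elliptic umbilic magnification relation. -/
theorem elliptic_umbilic_complex_magnification_relation (c : ℂ) (s : ℂ × ℂ)
    (η : ℂ × ℂ → ℂ × ℂ)
    (hη : ∀ x y : ℂ, η (x, y) = (x ^ 2 - y ^ 2, -2 * x * y + 4 * c * y))
    (J : ℂ × ℂ → ℂ)
    (hJ : ∀ x y : ℂ, J (x, y) =
      deriv (fun t => (η (t, y)).1) x * deriv (fun t => (η (x, t)).2) y -
      deriv (fun t => (η (x, t)).1) y * deriv (fun t => (η (t, y)).2) x)
    (hnc : ∀ q ∈ η ⁻¹' {s}, J q ≠ 0) :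
    (η ⁻¹' {s}).Finite ∧ ∑ᶠ q ∈ η ⁻¹' {s}, 1 / J q = 0 := by
  have hJ' : ∀ x y : ℂ, J (x, y) = -4 * (x * (x - 2 * c) + y ^ 2) := by
    intro x y
    have h₁ : HasDerivAt (fun t => (η (t, y)).1) (2 * x) x := by
      simpa [hη] using (hasDerivAt_pow 2 x).sub_const (y ^ 2)
    have h₂ : HasDerivAt (fun t => (η (x, t)).1) (-(2 * y)) y := by
      simpa [hη] using (hasDerivAt_pow 2 y).const_sub (x ^ 2)
    have h₃ : HasDerivAt (fun t => (η (t, y)).2) (-2 * y) x := by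
      simpa [hη] using (((hasDerivAt_id x).const_mul (-2)).mul_const y).add_const (4 * c * y)
    have h₄ : HasDerivAt (fun t => (η (x, t)).2) (-2 * x + 4 * c) y := by
      simpa [hη] using
        ((hasDerivAt_id y).const_mul (-2 * x)).fun_add ((hasDerivAt_id y).const_mul (4 * c))
    rw [hJ, h₁.deriv, h₂.deriv, h₃.deriv, h₄.deriv]
    ring
  obtain ⟨a, b⟩ := s
  have hfib : η ⁻¹' {(a, b)} =
      {q : ℂ × ℂ | q.1 ^ 2 - q.2 ^ 2 = a ∧ -2 * q.1 * q.2 + 4 * c * q.2 = b} := by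
    ext ⟨x, y⟩
    simp [hη]
  rw [hfib] at hnc ⊢
  by_cases hb : b = 0
  · subst hb
    obtain ⟨r, hr⟩ := IsAlgClosed.exists_pow_nat_eq a (n := 2) two_pos
    obtain ⟨w, hw⟩ := IsAlgClosed.exists_pow_nat_eq (4 * c ^ 2 - a) (n := 2) two_pos
    rw [elliptic_umbilic_fiber_axis hr hw] at hnc ⊢
    refine ⟨Finset.finite_toSet _, ?_⟩
    rw [finsum_mem_coe_finset]
    have h₁ := hnc (r, 0) (by simp)
    have h₂ := hnc (-r, 0) (by simp)
    have h₃ := hnc (2 * c, w) (by simp)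
    rw [hJ'] at h₁ h₂ h₃
    have hr₀ : r ≠ 0 := by rintro rfl; simp at h₁
    have hw₀ : w ≠ 0 := by rintro rfl; simp at h₃
    have hm : r - 2 * c ≠ 0 := fun h => h₁ (by linear_combination -4 * r * h)
    have hp : r + 2 * c ≠ 0 := fun h => h₂ (by linear_combination -4 * r * h)
    have hrr : r ≠ -r := self_ne_neg.2 hr₀
    have hww : w ≠ -w := self_ne_neg.2 hw₀
    rw [Finset.sum_insert (by simp [hrr, hw₀, hw₀.symm]), Finset.sum_insert (by simp [hw₀, hw₀.symm]),
      Finset.sum_insert (by simp [hww]), Finset.sum_singleton]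
    simp only [hJ']
    have e₁ : -4 * (r * (r - 2 * c) + 0 ^ 2) = -4 * r * (r - 2 * c) := by ring
    have e₂ : -4 * (-r * (-r - 2 * c) + 0 ^ 2) = -4 * r * (r + 2 * c) := by ring
    have e₃ : -4 * (2 * c * (2 * c - 2 * c) + w ^ 2) = 4 * ((r - 2 * c) * (r + 2 * c)) := by
      linear_combination -4 * hw - 4 * hr
    have e₄ : -4 * (2 * c * (2 * c - 2 * c) + (-w) ^ 2) = 4 * ((r - 2 * c) * (r + 2 * c)) := by
      linear_combination -4 * hw - 4 * hr
    rw [e₁, e₂, e₃, e₄]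
    field_simp
    ring
  · rw [elliptic_umbilic_fiber_eq_image hb] at hnc ⊢
    open Polynomial in
    set P : ℂ[X] := (X ^ 2 - C a) * (X - C (2 * c)) ^ 2 - C (b ^ 2 / 4) with hPdef
    have hdeg : P.natDegree = 4 := by rw [hPdef]; compute_degree!
    have hmonic : P.Monic := by rw [hPdef]; monicity!
    have heval : ∀ x, P.eval x = (x ^ 2 - a) * (x - 2 * c) ^ 2 - b ^ 2 / 4 := by
      intro x; simp [hPdef]
    have hroots : {x : ℂ | (x ^ 2 - a) * (x - 2 * c) ^ 2 - b ^ 2 / 4 = 0} =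
        (P.roots.toFinset : Set ℂ) := by
      ext x
      simp [hmonic.ne_zero, heval]
    have hx : ∀ x, P.eval x = 0 → x - 2 * c ≠ 0 := by
      intro x h h'
      rw [heval, h'] at h
      exact hb (by simpa using h)
    have hder : ∀ x, P.eval x = 0 → P.derivative.eval x =
        -(x - 2 * c) / 2 * J (x, b / (4 * c - 2 * x)) := by
      intro x h
      have h₀ := hx x h
      have h₁ : 4 * c - 2 * x ≠ 0 := fun h' => h₀ (by linear_combination -h' / 2)
      have hy : b / (4 * c - 2 * x) * (4 * c - 2 * x) = b := div_mul_cancel₀ b h₁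
      have hP' : P.derivative.eval x =
          2 * x * (x - 2 * c) ^ 2 + (x ^ 2 - a) * (2 * (x - 2 * c)) := by
        simp [hPdef, Polynomial.derivative_pow]
      rw [heval] at h
      rw [hJ', hP']
      refine mul_left_cancel₀ h₀ ?_
      linear_combination 2 * h - (b / (4 * c - 2 * x) * (4 * c - 2 * x) + b) / 2 * hy
    have hJne : ∀ x, P.eval x = 0 → J (x, b / (4 * c - 2 * x)) ≠ 0 := fun x h =>
      hnc _ ⟨x, by rwa [Set.mem_ofPred_eq, ← heval], rfl⟩
    rw [hroots]
    refine ⟨(Finset.finite_toSet _).image _, ?_⟩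
    rw [finsum_mem_image (fun x _ y _ h => congrArg Prod.fst h), finsum_mem_coe_finset]
    rw [← Polynomial.sum_roots_eval_div_derivative_eq_zero
      (Q := Polynomial.C (-1 / 2) * (Polynomial.X - Polynomial.C (2 * c))) hmonic
      (IsAlgClosed.splits P) ?_ ?_]
    · refine Finset.sum_congr rfl fun x h => ?_
      have h' : P.eval x = 0 := by simpa [hmonic.ne_zero] using h
      have h₁ := hx x h'
      have h₂ := hJne x h'
      simp only [hder x h', Polynomial.eval_mul, Polynomial.eval_C, Polynomial.eval_sub,
        Polynomial.eval_X]
      rw [div_eq_div_iff h₂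
        (mul_ne_zero (div_ne_zero (neg_ne_zero.2 h₁) two_ne_zero) h₂)]
      ring
    · intro x h
      rw [hder x h]
      exact mul_ne_zero (div_ne_zero (neg_ne_zero.2 (hx x h)) two_ne_zero) (hJne x h)
    · rw [hdeg]
      have : (Polynomial.C (-1 / 2) * (Polynomial.X - Polynomial.C (2 * c))).natDegree ≤ 1 := by
        compute_degree
      lia
end

section
/- Let c ∈ ℂ. Define the complexified hyperbolic umbilic map η : ℂ² → ℂ² by η(x,y) = (x² + 2cy, y² + 2cx). If s ∈ ℂ² is non-caustic, i.e., J_η(x,y) ≠ 0 for every (x,y) ∈ η⁻¹(s), then the fiber η⁻¹(s) is a finite set and Σ_{(x,y) ∈ η⁻¹(s)} 1/J_η(x,y) = 0. -/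
/-- **Euler–Jacobi formula in one variable**: for a monic polynomial of degree at least two with only
simple roots, the reciprocals of the derivative at the roots sum to zero. -/
theorem sum_roots_inv_eval_derivative_eq_zero {K : Type*} [Field K] [IsAlgClosed K] [DecidableEq K]
    {P : Polynomial K} (hP : P.Monic) (hdeg : 2 ≤ P.natDegree)
    (hsimple : ∀ r, P.eval r = 0 → P.derivative.eval r ≠ 0) :
    ∑ r ∈ P.roots.toFinset, (P.derivative.eval r)⁻¹ = 0 := by
  have hnodup : P.roots.Nodup := by
    rw [Multiset.nodup_iff_count_le_one]
    intro r
    rw [Polynomial.count_roots]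
    by_contra! h
    have h' := (Polynomial.one_lt_rootMultiplicity_iff_isRoot hP.ne_zero).1 h
    exact hsimple r h'.1 h'.2
  have hcard : P.roots.card = P.natDegree := (IsAlgClosed.splits P).natDegree_eq_card_roots.symm
  have hS : P.roots.toFinset.card = P.natDegree := by
    rw [Multiset.toFinset_card_of_nodup hnodup, hcard]
  have hnodal : Lagrange.nodal P.roots.toFinset id = P := by
    conv_rhs => rw [← Polynomial.prod_multiset_X_sub_C_of_monic_of_roots_card_eq hP hcard]
    rw [Lagrange.nodal, Finset.prod, Multiset.toFinset_val, hnodup.dedup]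
    rfl
  have hcoeff := Lagrange.coeff_eq_sum (s := P.roots.toFinset) (v := id) (P := (1 : Polynomial K))
    Function.injective_id.injOn (by rw [Polynomial.degree_one, hS]; exact_mod_cast by lia)
  rw [Polynomial.coeff_one, if_neg (by lia)] at hcoeff
  rw [hcoeff]
  refine Finset.sum_congr rfl fun r hr => ?_
  have h := Lagrange.eval_nodal_derivative_eval_node_eq (v := id) hr
  rw [hnodal, Lagrange.eval_nodal] at h
  rw [Polynomial.eval_one, one_div]
  exact congrArg _ h

/-- Complexified hyperbolic umbilic magnification relation. -/
theorem hyperbolic_umbilic_complex_magnification_relation (c : ℂ) (s : ℂ × ℂ)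
    (η : ℂ × ℂ → ℂ × ℂ)
    (hη : ∀ x y : ℂ, η (x, y) = (x ^ 2 + 2 * c * y, y ^ 2 + 2 * c * x))
    (J : ℂ × ℂ → ℂ)
    (hJ : ∀ x y : ℂ, J (x, y) =
      deriv (fun t => (η (t, y)).1) x * deriv (fun t => (η (x, t)).2) y -
      deriv (fun t => (η (x, t)).1) y * deriv (fun t => (η (t, y)).2) x)
    (hnc : ∀ q ∈ η ⁻¹' {s}, J q ≠ 0) :
    (η ⁻¹' {s}).Finite ∧ ∑ᶠ q ∈ η ⁻¹' {s}, 1 / J q = 0 := by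
  classical
  obtain ⟨p, q⟩ := s
  have hJ' (x y : ℂ) : J (x, y) = 4 * x * y - 4 * c ^ 2 := by
    rw [hJ]
    simp [hη]
    ring
  have hmem (x y : ℂ) :
      (x, y) ∈ η ⁻¹' {(p, q)} ↔ x ^ 2 + 2 * c * y = p ∧ y ^ 2 + 2 * c * x = q := by
    simp [hη]
  rcases eq_or_ne c 0 with rfl | hc
  · obtain ⟨a, rfl⟩ := IsAlgClosed.exists_pow_nat_eq p two_pos
    obtain ⟨b, rfl⟩ := IsAlgClosed.exists_pow_nat_eq q two_pos
    have hab : a ≠ 0 ∧ b ≠ 0 := by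
      have h := hnc (a, b) ((hmem a b).2 (by simp))
      simpa [hJ'] using h
    obtain ⟨ha, hb⟩ := hab
    have hfib : η ⁻¹' {(a ^ 2, b ^ 2)} = ↑(({a, -a} : Finset ℂ) ×ˢ ({b, -b} : Finset ℂ)) := by
      ext ⟨x, y⟩
      rw [hmem]
      simp [sq_eq_sq_iff_eq_or_eq_neg]
    rw [hfib]
    refine ⟨Finset.finite_toSet _, ?_⟩
    rw [finsum_mem_coe_finset, Finset.sum_product, Finset.sum_pair (self_ne_neg.2 ha)]
    simp only [Finset.sum_pair (self_ne_neg.2 hb), hJ']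
    field_simp
    ring
  · let P : Polynomial ℂ := Polynomial.X ^ 4 + (Polynomial.C (-2 * p) * Polynomial.X ^ 2 +
      Polynomial.C (8 * c ^ 3) * Polynomial.X + Polynomial.C (p ^ 2 - 4 * c ^ 2 * q))
    have hdeg : P.natDegree = 4 := by
      simp only [P]
      compute_degree!
    have hmonic : P.Monic := by
      simp only [P]
      monicity!
    let g : ℂ → ℂ × ℂ := fun r => (r, (p - r ^ 2) / (2 * c))
    have hJg (r : ℂ) : J (g r) = -(P.derivative.eval r) / (2 * c) := by
      have hderiv : P.derivative.eval r = 4 * r ^ 3 - 4 * p * r + 8 * c ^ 3 := by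
        simp only [P, Polynomial.derivative_add, Polynomial.derivative_C_mul,
          Polynomial.derivative_X_pow, Polynomial.derivative_X, Polynomial.derivative_C]
        simp
        ring
      simp only [g, hJ', hderiv]
      field_simp
      ring
    have hg (r : ℂ) (hr : P.eval r = 0) : g r ∈ η ⁻¹' {(p, q)} := by
      simp [P] at hr
      simp only [g]
      rw [hmem]
      constructor
      · field_simp
        ring
      · field_simp
        linear_combination hr
    have hroots (r : ℂ) : r ∈ (P.roots.toFinset : Set ℂ) ↔ P.eval r = 0 := by
      simp [hmonic.ne_zero]
    have hfib : η ⁻¹' {(p, q)} = g '' (P.roots.toFinset : Set ℂ) := by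
      ext ⟨x, y⟩
      constructor
      · intro h
        obtain ⟨h1, h2⟩ := (hmem x y).1 h
        refine ⟨x, ?_, ?_⟩
        · rw [hroots]
          simp [P]
          rw [← h1, ← h2]
          ring
        · simp only [g, ← h1]
          rw [add_sub_cancel_left, mul_div_cancel_left₀ y (by simpa using hc)]
      · rintro ⟨r, hr, h⟩
        rw [← h]
        exact hg r ((hroots r).1 hr)
    have hinj : Function.Injective g := fun r r' h => congrArg Prod.fst h
    have hsimple (r : ℂ) (hr : P.eval r = 0) : P.derivative.eval r ≠ 0 := by
      intro h
      exact hnc _ (hg r hr) (by rw [hJg, h]; simp)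
    rw [hfib]
    refine ⟨(Finset.finite_toSet _).image _, ?_⟩
    rw [finsum_mem_image hinj.injOn, finsum_mem_coe_finset]
    have hsum := sum_roots_inv_eval_derivative_eq_zero hmonic (by lia) hsimple
    calc ∑ r ∈ P.roots.toFinset, 1 / J (g r)
        = ∑ r ∈ P.roots.toFinset, -(2 * c) * (P.derivative.eval r)⁻¹ := by
          refine Finset.sum_congr rfl fun r _ => ?_
          rw [hJg, one_div_div, div_neg, div_eq_mul_inv, neg_mul]
      _ = 0 := by rw [← Finset.mul_sum, hsum, mul_zero]
end
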